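/- arXiv:1904.01055 — 4 statements merged into one kernel-verified Lean document; each statement's English description precedes it below -/
import Mathlib

section
/- Let c > 1 and let ℓ be a sufficiently large integer (ℓ ≥ ℓ₀ for an absolute constant ℓ₀). Suppose at least (1 − ℓ^{−1/5})·n vertices s of G satisfy ‖clip(p_s^ℓ, 1/4)‖₂² > ℓ^{−c}. Then there is a partition {P₁, P₂, …, P_b} of V such that: (i) for each P_i there exists a vertex s ∈ V with Σ_{t < 10ℓ^{c+1}} p_s^t(v) ≥ 1/(8ℓ^{c+1}) for every v ∈ P_i; and (ii) the total number of edges of G whose endpoints lie in different parts is at most 8·d·n·√(c·ℓ^{−1/5}·log ℓ). -/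
open scoped Classical

noncomputable section

/-- Transition matrix of the lazy random walk on `G` with step probability `1/(2d)`. -/
def lazyStep {V : Type*} [Fintype V] [DecidableEq V] (G : SimpleGraph V) [DecidableRel G.Adj]
    (d : ℕ) : Matrix V V ℝ :=
  Matrix.of fun u v =>
    if G.Adj u v then 1 / (2 * d)
    else if u = v then 1 - (G.degree u : ℝ) / (2 * d)
    else 0

/-- `walkDist G d t s v` is the probability that the `t`-step lazy random walk from `s` ends
at `v`. -/
def walkDist {V : Type*} [Fintype V] [DecidableEq V] (G : SimpleGraph V) [DecidableRel G.Adj]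
    (d t : ℕ) (s : V) : V → ℝ :=
  fun v => (lazyStep G d ^ t) s v

/-- The squared `ξ`-clipped `ℓ₂`-norm of a nonnegative vector `x`: the least squared `ℓ₂`-norm
of a vector `y` with `0 ≤ y ≤ x` entrywise and `‖x - y‖₁ ≤ ξ`. -/
def clipNormSq {W : Type*} [Fintype W] (x : W → ℝ) (ξ : ℝ) : ℝ :=
  sInf { r : ℝ | ∃ y : W → ℝ, (∀ v, 0 ≤ y v ∧ y v ≤ x v) ∧ (∑ v, |x v - y v|) ≤ ξ ∧
    r = ∑ v, y v ^ 2 }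

/-- A matrix with nonnegative entries. -/
def EntrywiseNonneg {V : Type*} (M : Matrix V V ℝ) : Prop := ∀ i j, 0 ≤ M i j

namespace EntrywiseNonneg

variable {V : Type*} {M N : Matrix V V ℝ}

lemma add (hM : EntrywiseNonneg M) (hN : EntrywiseNonneg N) : EntrywiseNonneg (M + N) :=
  fun i j => add_nonneg (hM i j) (hN i j)

lemma mul [Fintype V] (hM : EntrywiseNonneg M) (hN : EntrywiseNonneg N) :
    EntrywiseNonneg (M * N) :=
  fun i j => by
    rw [Matrix.mul_apply]
    exact Finset.sum_nonneg fun k _ => mul_nonneg (hM i k) (hN k j)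

lemma zero : EntrywiseNonneg (0 : Matrix V V ℝ) := fun _ _ => le_rfl

lemma one [DecidableEq V] : EntrywiseNonneg (1 : Matrix V V ℝ) := fun i j => by
  rw [Matrix.one_apply]; split_ifs <;> norm_num

lemma pow [Fintype V] [DecidableEq V] (hM : EntrywiseNonneg M) (k : ℕ) :
    EntrywiseNonneg (M ^ k) := by
  induction k with
  | zero => rw [pow_zero]; exact one
  | succ k ih => rw [pow_succ]; exact ih.mul hM

end EntrywiseNonneg

/-- A bound on the sums of `x` over sets extends to fractional sets. -/
lemma sum_mul_le_of_sum_le {V : Type*} [Fintype V] {F : Finset V} {x : V → ℝ} {θ g : ℝ} (hg : 0 ≤ g)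
    (hx : ∀ B ⊆ F, ∑ v ∈ B, x v ≤ θ * B.card + g * √B.card) {w : V → ℝ}
    (hw : ∀ v, w v ∈ Set.Icc (0 : ℝ) 1) :
    ∑ v ∈ F, x v * w v ≤ θ * ∑ v ∈ F, w v + g * √(∑ v ∈ F, w v) := by
  let f : (V → ℝ) → ℝ := fun w => ∑ v ∈ F, (x v - θ) * w v + g * -√(∑ v ∈ F, w v)
  have hhull : convexHull ℝ (Set.univ.pi fun _ : V => ({0, 1} : Set ℝ)) =
      Set.univ.pi fun _ : V => Set.Icc (0 : ℝ) 1 := by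
    rw [convexHull_pi]
    simp [convexHull_pair, segment_eq_Icc]
  have hf : ConvexOn ℝ (convexHull ℝ (Set.univ.pi fun _ : V => ({0, 1} : Set ℝ))) f := by
    refine ⟨convex_convexHull ℝ _, ?_⟩
    rw [hhull]
    intro y hy z hz a b ha hb hab
    have hy' : 0 ≤ ∑ v ∈ F, y v := Finset.sum_nonneg fun v _ => (hy v trivial).1
    have hz' : 0 ≤ ∑ v ∈ F, z v := Finset.sum_nonneg fun v _ => (hz v trivial).1
    have hc := Real.strictConcaveOn_sqrt.concaveOn.2 hy' hz' ha hb hab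
    simp only [smul_eq_mul] at hc
    simp only [f, Pi.add_apply, Pi.smul_apply, smul_eq_mul, Finset.sum_add_distrib,
      ← Finset.mul_sum, mul_add]
    have h1 : ∀ (t : ℝ) (y : V → ℝ), ∑ v ∈ F, (x v - θ) * (t * y v) =
        t * ∑ v ∈ F, (x v - θ) * y v := fun t y => by
      rw [Finset.mul_sum]; exact Finset.sum_congr rfl fun _ _ => by ring
    rw [h1, h1]
    nlinarith [mul_le_mul_of_nonneg_left hc hg]
  have hmem : w ∈ convexHull ℝ (Set.univ.pi fun _ : V => ({0, 1} : Set ℝ)) := by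
    rw [hhull]; exact fun v _ => hw v
  obtain ⟨y, hy, hwy⟩ := hf.exists_ge_of_mem_convexHull (subset_convexHull ℝ _) hmem
  have hB := hx (F.filter fun v => y v = 1) (Finset.filter_subset _ _)
  have hyc : ∑ v ∈ F, y v = (F.filter fun v => y v = 1).card := by
    rw [Finset.card_filter, Nat.cast_sum]
    refine Finset.sum_congr rfl fun v _ => ?_
    have := hy v trivial
    simp only [Set.mem_insert_iff, Set.mem_singleton_iff] at this
    rcases this with h | h <;> simp [h]
  have hyx : ∑ v ∈ F, x v * y v = ∑ v ∈ F.filter (fun v => y v = 1), x v := by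
    rw [Finset.sum_filter]
    refine Finset.sum_congr rfl fun v _ => ?_
    have := hy v trivial
    simp only [Set.mem_insert_iff, Set.mem_singleton_iff] at this
    rcases this with h | h <;> simp [h]
  simp only [f, sub_mul, Finset.sum_sub_distrib, ← Finset.mul_sum, hyc, hyx] at hwy
  linarith

lemma sqrt_sub_add_sqrt_add_le {N q φ a b : ℝ} (hφ : 0 ≤ φ) (hq : φ * N ≤ q)
    (ha : 0 ≤ a) (haN : a ≤ N - 2 * q) (hb : b ≤ N + 2 * q) (hN : 0 < N) :
    √a + √b ≤ 2 * (Real.exp (-φ ^ 2 / 2) * √N) := by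
  have hq0 : 0 ≤ q := le_trans (by positivity) hq
  have h1 : √a ≤ √(N - 2 * q) := Real.sqrt_le_sqrt haN
  have h2 : √b ≤ √(N + 2 * q) := Real.sqrt_le_sqrt hb
  refine (add_le_add h1 h2).trans (abs_le_of_sq_le_sq' ?_ (by positivity)).2
  have hprod : √(N - 2 * q) * √(N + 2 * q) ≤ N - 2 * φ ^ 2 * N := by
    rw [← Real.sqrt_mul (by linarith)]
    refine Real.sqrt_le_iff.2 ⟨?_, ?_⟩
    · nlinarith [mul_nonneg hφ hN.le]
    · nlinarith [mul_nonneg hφ hN.le, sq_nonneg (φ ^ 2 * N)]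
  have hexp : 1 - φ ^ 2 ≤ Real.exp (-φ ^ 2 / 2) ^ 2 := by
    rw [← Real.exp_nat_mul]
    have := Real.add_one_le_exp (-φ ^ 2)
    convert (by linarith : 1 - φ ^ 2 ≤ Real.exp (-φ ^ 2)) using 2
    push_cast; ring
  have e1 := Real.sq_sqrt (show 0 ≤ N - 2 * q by linarith)
  have e2 := Real.sq_sqrt (show 0 ≤ N + 2 * q by linarith)
  have e3 := Real.sq_sqrt hN.le
  calc (√(N - 2 * q) + √(N + 2 * q)) ^ 2
      = 2 * N + 2 * (√(N - 2 * q) * √(N + 2 * q)) := by nlinarith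
    _ ≤ 4 * ((1 - φ ^ 2) * N) := by linarith
    _ ≤ 4 * (Real.exp (-φ ^ 2 / 2) ^ 2 * N) := by gcongr
    _ = (2 * (Real.exp (-φ ^ 2 / 2) * √N)) ^ 2 := by rw [mul_pow, mul_pow, e3]; ring

section Chain

open scoped Matrix

variable {V : Type*} [DecidableEq V]

/-- The diagonal projection onto the coordinates in `F`. -/
def coordProj (F : Finset V) : Matrix V V ℝ :=
  Matrix.diagonal fun v => if v ∈ F then 1 else 0

lemma coordProj_nonneg (F : Finset V) : EntrywiseNonneg (coordProj F) := fun i j => by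
  rw [coordProj, Matrix.diagonal_apply]; split_ifs <;> norm_num

lemma coordProj_transpose (F : Finset V) : (coordProj F)ᵀ = coordProj F :=
  Matrix.diagonal_transpose _

variable [Fintype V]

lemma mul_coordProj_apply (M : Matrix V V ℝ) (F : Finset V) (u v : V) :
    (M * coordProj F) u v = if v ∈ F then M u v else 0 := by
  rw [coordProj, Matrix.mul_diagonal]; split_ifs <;> simp

lemma coordProj_mul_apply (M : Matrix V V ℝ) (F : Finset V) (u v : V) :
    (coordProj F * M) u v = if u ∈ F then M u v else 0 := by
  rw [coordProj, Matrix.diagonal_mul]; split_ifs <;> simp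

lemma coordProj_add_compl (F : Finset V) : coordProj F + coordProj Fᶜ = 1 := by
  ext u v
  simp only [coordProj, Matrix.add_apply, Matrix.diagonal_apply, Matrix.one_apply,
    Finset.mem_compl]
  split_ifs <;> simp_all

lemma coordProj_mul_compl (F : Finset V) : coordProj F * coordProj Fᶜ = 0 := by
  ext u v
  rw [mul_coordProj_apply, coordProj, Matrix.diagonal_apply]
  simp only [Finset.mem_compl, Matrix.zero_apply]
  split_ifs <;> simp_all

/-- `fewVisits P F t k u v` is the probability that the chain `P` started at `u` is at `v` at
time `t` and has been in `F` fewer than `k` times during the times `1, …, t`. -/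
def fewVisits (P : Matrix V V ℝ) (F : Finset V) : ℕ → ℕ → Matrix V V ℝ
  | _, 0 => 0
  | 0, _ + 1 => 1
  | t + 1, k + 1 =>
    fewVisits P F t (k + 1) * P * coordProj Fᶜ + fewVisits P F t k * P * coordProj F

/-- `visits P F t k u v` is the probability that the chain `P` started at `u` is at `v` at
time `t` and has been in `F` exactly `k` times during the times `1, …, t`. -/
def visits (P : Matrix V V ℝ) (F : Finset V) (t k : ℕ) : Matrix V V ℝ :=
  fewVisits P F t (k + 1) - fewVisits P F t k

variable {P : Matrix V V ℝ} {F : Finset V}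

@[simp] lemma fewVisits_zero_right (t : ℕ) : fewVisits P F t 0 = 0 := by
  cases t <;> rfl

@[simp] lemma fewVisits_zero_succ (k : ℕ) : fewVisits P F 0 (k + 1) = 1 := rfl

lemma fewVisits_succ_succ (t k : ℕ) : fewVisits P F (t + 1) (k + 1) =
    fewVisits P F t (k + 1) * P * coordProj Fᶜ + fewVisits P F t k * P * coordProj F := rfl

lemma fewVisits_succ_succ' (t k : ℕ) : fewVisits P F (t + 1) (k + 1) =
    P * coordProj Fᶜ * fewVisits P F t (k + 1) + P * coordProj F * fewVisits P F t k := by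
  induction t generalizing k with
  | zero =>
    cases k <;> simp [fewVisits_succ_succ]
  | succ t ih =>
    cases k with
    | zero =>
      conv_lhs => rw [fewVisits_succ_succ, ih]
      conv_rhs => rw [fewVisits_succ_succ]
      simp only [fewVisits_zero_right]
      noncomm_ring
    | succ k =>
      conv_lhs => rw [fewVisits_succ_succ, ih, ih]
      conv_rhs => rw [fewVisits_succ_succ, fewVisits_succ_succ]
      noncomm_ring

lemma visits_succ_succ (t k : ℕ) : visits P F (t + 1) (k + 1) =
    visits P F t (k + 1) * P * coordProj Fᶜ + visits P F t k * P * coordProj F := by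
  simp only [visits, fewVisits_succ_succ]
  noncomm_ring

lemma visits_zero_succ (k : ℕ) : visits P F 0 (k + 1) = 0 := by simp [visits]

lemma visits_zero_zero : visits P F 0 0 = 1 := by simp [visits]

lemma visits_succ_mul_compl (t k : ℕ) :
    visits P F (t + 1) k * coordProj Fᶜ = visits P F t k * P * coordProj Fᶜ := by
  have h1 : coordProj Fᶜ * coordProj Fᶜ = coordProj Fᶜ := by
    ext u v; rw [mul_coordProj_apply, coordProj, Matrix.diagonal_apply]; split_ifs <;> simp_all
  cases k with
  | zero =>
    simp only [visits, fewVisits_succ_succ, fewVisits_zero_right, zero_mul, add_zero, sub_zero,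
      Matrix.mul_assoc, h1]
  | succ k =>
    simp only [visits_succ_succ, add_mul, Matrix.mul_assoc, h1, coordProj_mul_compl, mul_zero,
      add_zero]

lemma visits_succ_succ_mul (t k : ℕ) :
    visits P F (t + 1) (k + 1) * coordProj F = visits P F t k * P * coordProj F := by
  have h1 : coordProj F * coordProj F = coordProj F := by
    ext u v; rw [mul_coordProj_apply, coordProj, Matrix.diagonal_apply]; split_ifs <;> simp_all
  have h2 : coordProj Fᶜ * coordProj F = 0 := by
    simpa using coordProj_mul_compl Fᶜ
  simp only [visits_succ_succ, add_mul, Matrix.mul_assoc, h1, h2, mul_zero, zero_add]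

lemma visits_nonneg (hP : EntrywiseNonneg P) (t k : ℕ) : EntrywiseNonneg (visits P F t k) := by
  induction t generalizing k with
  | zero =>
    cases k with
    | zero => rw [visits_zero_zero]; exact .one
    | succ k => rw [visits_zero_succ]; exact .zero
  | succ t ih =>
    cases k with
    | zero =>
      have h : visits P F (t + 1) 0 = visits P F t 0 * P * coordProj Fᶜ := by
        simp [visits, fewVisits_succ_succ]
      rw [h]
      exact ((ih 0).mul hP).mul (coordProj_nonneg _)
    | succ k =>
      rw [visits_succ_succ]
      exact (((ih _).mul hP).mul (coordProj_nonneg _)).add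
        (((ih _).mul hP).mul (coordProj_nonneg _))

lemma fewVisits_nonneg (hP : EntrywiseNonneg P) (t k : ℕ) :
    EntrywiseNonneg (fewVisits P F t k) := by
  induction k with
  | zero => rw [fewVisits_zero_right]; exact .zero
  | succ k ih =>
    rw [show fewVisits P F t (k + 1) = fewVisits P F t k + visits P F t k by simp [visits]]
    exact ih.add (visits_nonneg hP t k)

lemma pow_sub_fewVisits_succ (t k : ℕ) : P ^ (t + 1) - fewVisits P F (t + 1) (k + 1) =
    (P ^ t - fewVisits P F t (k + 1)) * P + visits P F (t + 1) (k + 1) * coordProj F := by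
  have h : coordProj Fᶜ = 1 - coordProj F := by rw [← coordProj_add_compl F]; abel
  rw [visits_succ_succ_mul, fewVisits_succ_succ, visits, h, pow_succ]
  noncomm_ring

lemma pow_sub_fewVisits_nonneg (hP : EntrywiseNonneg P) (t k : ℕ) :
    EntrywiseNonneg (P ^ t - fewVisits P F t k) := by
  cases k with
  | zero => simpa using hP.pow t
  | succ k =>
    induction t with
    | zero => simpa using EntrywiseNonneg.zero
    | succ t ih =>
      rw [pow_sub_fewVisits_succ]
      exact (ih.mul hP).add ((visits_nonneg hP _ _).mul (coordProj_nonneg _))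

lemma visits_le_pow (hP : EntrywiseNonneg P) (t k : ℕ) (u v : V) :
    visits P F t k u v ≤ (P ^ t) u v := by
  have h1 := pow_sub_fewVisits_nonneg (F := F) hP t (k + 1) u v
  have h2 := fewVisits_nonneg (F := F) hP t k u v
  simp only [visits, Matrix.sub_apply] at *
  linarith

/-- The probability of having visited `F` fewer than `k` times decreases with time. -/
lemma sum_fewVisits_succ_le (hP : EntrywiseNonneg P) (hrow : ∀ u, ∑ v, P u v = 1)
    (t k : ℕ) (u : V) :
    ∑ v, fewVisits P F (t + 1) k u v ≤ ∑ v, fewVisits P F t k u v := by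
  cases k with
  | zero => simp
  | succ k =>
    have h : fewVisits P F (t + 1) (k + 1) =
        fewVisits P F t (k + 1) * P - visits P F t k * P * coordProj F := by
      have h : coordProj Fᶜ = 1 - coordProj F := by rw [← coordProj_add_compl F]; abel
      rw [fewVisits_succ_succ, visits, h]
      noncomm_ring
    have h1 : ∑ v, (fewVisits P F t (k + 1) * P) u v = ∑ v, fewVisits P F t (k + 1) u v := by
      simp only [Matrix.mul_apply]
      rw [Finset.sum_comm]
      simp only [← Finset.mul_sum, hrow, mul_one]
    rw [h, ← h1]
    refine Finset.sum_le_sum fun v _ => ?_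
    have := ((visits_nonneg (F := F) hP t k).mul hP).mul (coordProj_nonneg F) u v
    rw [Matrix.sub_apply]
    linarith

/-- Starting from a random vertex of `F`, a stationary walk rarely visits `F` few times. -/
lemma mul_sum_fewVisits_le (hP : EntrywiseNonneg P) (hsymm : Pᵀ = P)
    (hrow : ∀ u, ∑ v, P u v = 1) (t k : ℕ) :
    (t : ℝ) * ∑ u ∈ F, ∑ v, fewVisits P F t k u v ≤ Fintype.card V * k := by
  have hcol : ∀ v, ∑ u, P u v = 1 := fun v => by
    rw [← hrow v]
    exact Finset.sum_congr rfl fun u _ => congrFun (congrFun hsymm v) u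
  have hsum : ∀ (B : Finset V) (M : Matrix V V ℝ),
      ∑ u, ∑ v, (P * coordProj B * M) u v = ∑ u ∈ B, ∑ v, M u v := by
    intro B M
    calc ∑ u, ∑ v, (P * coordProj B * M) u v
        = ∑ u, ∑ w, (if w ∈ B then P u w else 0) * ∑ v, M w v := by
          refine Finset.sum_congr rfl fun u _ => ?_
          simp only [Matrix.mul_apply (M := P * coordProj B), mul_coordProj_apply,
            Finset.mul_sum]
          exact Finset.sum_comm
      _ = ∑ w, ∑ u, (if w ∈ B then P u w else 0) * ∑ v, M w v := Finset.sum_comm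
      _ = ∑ w, if w ∈ B then ∑ v, M w v else 0 := by
          refine Finset.sum_congr rfl fun w _ => ?_
          rw [← Finset.sum_mul]
          split_ifs <;> simp [hcol]
      _ = ∑ u ∈ B, ∑ v, M u v := by simp
  have hdrop : ∀ m j, ∑ u ∈ F, ∑ v, visits P F m j u v =
      ∑ u, ∑ v, fewVisits P F m (j + 1) u v - ∑ u, ∑ v, fewVisits P F (m + 1) (j + 1) u v := by
    intro m j
    simp only [fewVisits_succ_succ', Matrix.add_apply, Finset.sum_add_distrib, hsum, visits,
      Matrix.sub_apply, Finset.sum_sub_distrib]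
    rw [← Finset.sum_add_sum_compl F (fun u => ∑ v, fewVisits P F m (j + 1) u v)]
    ring
  have hj : ∀ j, ∑ m ∈ Finset.range t, ∑ u ∈ F, ∑ v, visits P F m j u v ≤ Fintype.card V := by
    intro j
    simp only [hdrop]
    rw [Finset.sum_range_sub' (fun m => ∑ u, ∑ v, fewVisits P F m (j + 1) u v)]
    have h0 : ∑ u, ∑ v, fewVisits P F 0 (j + 1) u v = Fintype.card V := by
      simp [Matrix.one_apply]
    have := Finset.sum_nonneg fun u (_ : u ∈ Finset.univ) => Finset.sum_nonneg fun v
      (_ : v ∈ Finset.univ) => fewVisits_nonneg (F := F) hP t (j + 1) u v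
    linarith
  have hk : ∑ m ∈ Finset.range t, ∑ u ∈ F, ∑ v, fewVisits P F m k u v ≤ Fintype.card V * k := by
    induction k with
    | zero => simp
    | succ k ih =>
      have h : ∀ m, fewVisits P F m (k + 1) = fewVisits P F m k + visits P F m k := fun m => by
        simp [visits]
      simp only [h, Matrix.add_apply, Finset.sum_add_distrib]
      push_cast
      linarith [hj k]
  have hanti : ∀ u, Antitone fun m => ∑ v, fewVisits P F m k u v := fun u =>
    antitone_nat_of_succ_le fun m => sum_fewVisits_succ_le hP hrow m k u
  calc (t : ℝ) * ∑ u ∈ F, ∑ v, fewVisits P F t k u v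
      = ∑ m ∈ Finset.range t, ∑ u ∈ F, ∑ v, fewVisits P F t k u v := by simp
    _ ≤ ∑ m ∈ Finset.range t, ∑ u ∈ F, ∑ v, fewVisits P F m k u v :=
      Finset.sum_le_sum fun m hm => Finset.sum_le_sum fun u _ =>
        hanti u (Finset.mem_range.1 hm).le
    _ ≤ _ := hk

/-- `excursion P F m u v`, for `u v ∈ F`, is the probability that the chain `P` started at `u`
returns to `F` within `m + 1` steps, and does so at `v`. -/
def excursion (P : Matrix V V ℝ) (F : Finset V) : ℕ → Matrix V V ℝ
  | 0 => P
  | m + 1 => P + P * coordProj Fᶜ * excursion P F m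

lemma excursion_succ (m : ℕ) :
    excursion P F (m + 1) = P + P * coordProj Fᶜ * excursion P F m := rfl

lemma excursion_succ' (m : ℕ) :
    excursion P F (m + 1) = P + excursion P F m * coordProj Fᶜ * P := by
  induction m with
  | zero => rfl
  | succ m ih =>
    conv_lhs => rw [excursion_succ, ih]
    conv_rhs => rw [excursion_succ]
    noncomm_ring

lemma excursion_transpose (hsymm : Pᵀ = P) (m : ℕ) : (excursion P F m)ᵀ = excursion P F m := by
  induction m with
  | zero => exact hsymm
  | succ m ih =>
    conv_rhs => rw [excursion_succ']
    rw [excursion_succ, Matrix.transpose_add, Matrix.transpose_mul, Matrix.transpose_mul, ih,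
      hsymm, coordProj_transpose, Matrix.mul_assoc]

lemma excursion_nonneg (hP : EntrywiseNonneg P) (m : ℕ) : EntrywiseNonneg (excursion P F m) := by
  induction m with
  | zero => exact hP
  | succ m ih => exact hP.add ((hP.mul (coordProj_nonneg _)).mul ih)

lemma le_excursion (hP : EntrywiseNonneg P) (m : ℕ) (u v : V) : P u v ≤ excursion P F m u v := by
  cases m with
  | zero => exact le_rfl
  | succ m =>
    have := (hP.mul (coordProj_nonneg Fᶜ)).mul (excursion_nonneg (F := F) hP m) u v
    rw [excursion_succ, Matrix.add_apply]
    linarith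

lemma sum_excursion_le_one (hP : EntrywiseNonneg P) (hrow : ∀ u, ∑ v, P u v = 1) (m : ℕ)
    (u : V) : ∑ v ∈ F, excursion P F m u v ≤ 1 := by
  induction m generalizing u with
  | zero =>
    rw [← hrow u]
    exact Finset.sum_le_sum_of_subset_of_nonneg (Finset.subset_univ _) fun v _ _ => hP u v
  | succ m ih =>
    have h : ∑ v ∈ F, (P * coordProj Fᶜ * excursion P F m) u v ≤ ∑ w ∈ Fᶜ, P u w := by
      simp only [Matrix.mul_apply (M := P * coordProj Fᶜ), mul_coordProj_apply]
      rw [Finset.sum_comm]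
      simp only [← Finset.mul_sum]
      simp only [ite_mul, zero_mul, Finset.sum_ite_mem, Finset.univ_inter]
      exact Finset.sum_le_sum fun w _ => mul_le_of_le_one_right (hP u w) (ih w)
    simp only [excursion_succ, Matrix.add_apply, Finset.sum_add_distrib]
    have := hrow u
    rw [← Finset.sum_add_sum_compl F] at this
    linarith

/-- Expected number of times `τ ≤ m` at which exactly `k` visits to `F` have been made and the
chain is at the given vertex. -/
def occupation (P : Matrix V V ℝ) (F : Finset V) (m k : ℕ) : Matrix V V ℝ :=
  ∑ τ ∈ Finset.range (m + 1), visits P F τ k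

lemma occupation_succ (m k : ℕ) :
    occupation P F (m + 1) k = occupation P F m k + visits P F (m + 1) k :=
  Finset.sum_range_succ _ _

lemma occupation_zero (k : ℕ) : occupation P F 0 k = visits P F 0 k := by simp [occupation]

lemma coordProj_mul_visits_zero_mul_compl (k : ℕ) :
    coordProj F * visits P F 0 k * coordProj Fᶜ = 0 := by
  cases k with
  | zero => rw [visits_zero_zero, mul_one, coordProj_mul_compl]
  | succ k => rw [visits_zero_succ, mul_zero, zero_mul]

lemma coordProj_mul_occupation_succ_mul_compl (m k : ℕ) :
    coordProj F * occupation P F (m + 1) k * coordProj Fᶜ =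
      coordProj F * occupation P F m k * P * coordProj Fᶜ := by
  induction m with
  | zero =>
    rw [occupation_succ, mul_add, add_mul, occupation_zero, coordProj_mul_visits_zero_mul_compl,
      Matrix.mul_assoc, visits_succ_mul_compl]
    simp only [Matrix.mul_assoc, zero_add]
  | succ m ih =>
    rw [occupation_succ, mul_add, add_mul, ih, Matrix.mul_assoc _ (visits P F (m + 1 + 1) k),
      visits_succ_mul_compl, occupation_succ]
    noncomm_ring

lemma occupation_succ_succ_mul (m k : ℕ) :
    occupation P F (m + 1) (k + 1) * coordProj F = occupation P F m k * P * coordProj F := by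
  induction m with
  | zero =>
    rw [occupation_succ, occupation_zero, occupation_zero, visits_zero_succ, zero_add,
      visits_succ_succ_mul]
  | succ m ih =>
    rw [occupation_succ, add_mul, ih, visits_succ_succ_mul, occupation_succ]
    noncomm_ring

lemma occupation_mul_le (hP : EntrywiseNonneg P) (m k : ℕ) :
    EntrywiseNonneg (coordProj F * occupation P F m k * coordProj F * excursion P F m -
      coordProj F * occupation P F m k * P) := by
  have hsplit : ∀ M : Matrix V V ℝ, M * P = M * coordProj F * P + M * coordProj Fᶜ * P := by
    intro M
    rw [← add_mul, ← mul_add, coordProj_add_compl, mul_one]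
  induction m with
  | zero =>
    rw [hsplit (coordProj F * occupation P F 0 k), occupation_zero,
      coordProj_mul_visits_zero_mul_compl]
    simpa [excursion] using EntrywiseNonneg.zero
  | succ m ih =>
    have h : coordProj F * occupation P F (m + 1) k * coordProj F * excursion P F (m + 1) -
        coordProj F * occupation P F (m + 1) k * P =
        (coordProj F * occupation P F m k * coordProj F * excursion P F m -
          coordProj F * occupation P F m k * P) * (coordProj Fᶜ * P) +
        coordProj F * visits P F (m + 1) k * coordProj F * excursion P F m *
          (coordProj Fᶜ * P) := by
      rw [hsplit (coordProj F * occupation P F (m + 1) k),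
        coordProj_mul_occupation_succ_mul_compl, excursion_succ', occupation_succ]
      noncomm_ring
    rw [h]
    have hC := (coordProj_nonneg Fᶜ).mul hP
    exact (ih.mul hC).add (((((coordProj_nonneg F).mul (visits_nonneg hP _ _)).mul
      (coordProj_nonneg F)).mul (excursion_nonneg hP m)).mul hC)

lemma occupation_succ_le (hP : EntrywiseNonneg P) (m k : ℕ) {s v : V} (hs : s ∈ F)
    (hv : v ∈ F) : occupation P F m (k + 1) s v ≤
      ∑ u ∈ F, occupation P F m k s u * excursion P F m u v := by
  have h1 : occupation P F m (k + 1) s v ≤ (occupation P F m k * P) s v := by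
    have h : (occupation P F (m + 1) (k + 1) * coordProj F) s v =
        (occupation P F m k * P * coordProj F) s v := by rw [occupation_succ_succ_mul]
    rw [mul_coordProj_apply, mul_coordProj_apply, if_pos hv, if_pos hv, occupation_succ,
      Matrix.add_apply] at h
    linarith [visits_nonneg (F := F) hP (m + 1) (k + 1) s v]
  have h2 := occupation_mul_le (F := F) hP m k s v
  rw [Matrix.sub_apply, Matrix.mul_assoc (coordProj F) _ P, coordProj_mul_apply, if_pos hs,
    Matrix.mul_apply] at h2
  simp only [mul_coordProj_apply, coordProj_mul_apply, if_pos hs, ite_mul, zero_mul,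
    Finset.sum_ite_mem, Finset.univ_inter] at h2
  linarith

/-- One step of the Lovász–Simonovits argument for a symmetric lazy substochastic kernel. -/
lemma lovasz_simonovits_step {K : Matrix V V ℝ} (hK : EntrywiseNonneg K) (hsymm : Kᵀ = K)
    (hrow : ∀ u, ∑ v ∈ F, K u v ≤ 1) (hlazy : ∀ u, 1 / 2 ≤ K u u) {x : V → ℝ} {θ g φ : ℝ}
    (hθ : 0 ≤ θ) (hg : 0 ≤ g) (hφ : 0 ≤ φ)
    (hx : ∀ B ⊆ F, ∑ v ∈ B, x v ≤ θ * B.card + g * √B.card)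
    {A : Finset V} (hA : A ⊆ F) (hcut : φ * A.card ≤ ∑ u ∈ A, ∑ v ∈ F \ A, K u v) :
    ∑ u ∈ F, x u * ∑ v ∈ A, K u v ≤
      θ * A.card + g * Real.exp (-φ ^ 2 / 2) * √A.card := by
  rcases A.eq_empty_or_nonempty with rfl | hne
  · simp
  set q := ∑ u ∈ A, ∑ v ∈ F \ A, K u v with hq
  set m : V → ℝ := fun u => ∑ v ∈ A, K u v with hm
  have hm0 : ∀ u, 0 ≤ m u := fun u => Finset.sum_nonneg fun v _ => hK u v
  have hsplit : ∀ u, m u + ∑ v ∈ F \ A, K u v ≤ 1 := fun u => by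
    rw [add_comm, hm, Finset.sum_sdiff hA]; exact hrow u
  have hout : ∀ u, 0 ≤ ∑ v ∈ F \ A, K u v := fun u => Finset.sum_nonneg fun v _ => hK u v
  have hmA : ∀ u ∈ A, 1 / 2 ≤ m u := fun u hu =>
    (hlazy u).trans (Finset.single_le_sum (f := fun v => K u v) (fun v _ => hK u v) hu)
  have hmout : ∀ u ∈ F \ A, m u ≤ 1 / 2 := fun u hu => by
    have := (hlazy u).trans
      (Finset.single_le_sum (f := fun v => K u v) (fun v _ => hK u v) hu)
    linarith [hsplit u]
  let w₁ : V → ℝ := fun u => if u ∈ A then 2 * m u - 1 else 0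
  let w₂ : V → ℝ := fun u => if u ∈ A then 1 else if u ∈ F then 2 * m u else 0
  have hw₁ : ∀ u, w₁ u ∈ Set.Icc (0 : ℝ) 1 := fun u => by
    by_cases hu : u ∈ A
    · simp only [w₁, if_pos hu]
      constructor <;> linarith [hmA u hu, hsplit u, hout u]
    · simp [w₁, hu]
  have hw₂ : ∀ u, w₂ u ∈ Set.Icc (0 : ℝ) 1 := fun u => by
    by_cases hu : u ∈ A
    · simp [w₂, hu]
    · by_cases hF : u ∈ F
      · simp only [w₂, if_neg hu, if_pos hF]
        constructor <;> linarith [hm0 u, hmout u (Finset.mem_sdiff.2 ⟨hF, hu⟩)]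
      · simp [w₂, hu, hF]
  have hW₁ : ∑ u ∈ F, w₁ u = ∑ u ∈ A, (2 * m u - 1) := by
    simp only [w₁, Finset.sum_ite_mem, Finset.inter_eq_right.2 hA]
  have hW₁' : ∑ u ∈ A, (2 * m u - 1) ≤ A.card - 2 * q := by
    have : ∑ u ∈ A, (m u + ∑ v ∈ F \ A, K u v) ≤ ∑ u ∈ A, (1 : ℝ) :=
      Finset.sum_le_sum fun u _ => hsplit u
    rw [Finset.sum_add_distrib, ← hq] at this
    rw [Finset.sum_sub_distrib, ← Finset.mul_sum]
    simp only [Finset.sum_const, nsmul_eq_mul, mul_one] at this ⊢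
    linarith
  have hW₂ : ∑ u ∈ F, w₂ u = A.card + 2 * q := by
    rw [← Finset.sum_sdiff hA]
    have h1 : ∑ u ∈ A, w₂ u = A.card := by
      rw [Finset.sum_congr rfl fun u hu => if_pos hu]; simp
    have h2 : ∑ u ∈ F \ A, w₂ u = 2 * q := by
      have : ∀ u ∈ F \ A, w₂ u = 2 * m u := fun u hu => by
        rw [Finset.mem_sdiff] at hu
        simp [w₂, hu.1, hu.2]
      rw [Finset.sum_congr rfl this, ← Finset.mul_sum, hq]
      congr 1
      exact Finset.sum_comm.trans (Finset.sum_congr rfl fun u _ => Finset.sum_congr rfl fun v _ =>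
        congrFun (congrFun hsymm u) v)
    rw [h1, h2, add_comm]
  have hm₁₂ : ∀ u ∈ F, x u * m u = (x u * w₁ u + x u * w₂ u) / 2 := fun u hu => by
    by_cases h : u ∈ A
    · simp only [w₁, w₂, if_pos h]; ring
    · simp only [w₁, w₂, if_neg h, if_pos hu]; ring
  have hb₁ := sum_mul_le_of_sum_le hg hx hw₁
  have hb₂ := sum_mul_le_of_sum_le hg hx hw₂
  have hN : (0 : ℝ) < A.card := by exact_mod_cast hne.card_pos
  have hs := sqrt_sub_add_sqrt_add_le hφ hcut (a := ∑ u ∈ F, w₁ u) (b := ∑ u ∈ F, w₂ u)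
    (Finset.sum_nonneg fun u _ => (hw₁ u).1) (hW₁ ▸ hW₁') hW₂.le hN
  have hθW : θ * ∑ u ∈ F, w₁ u + θ * ∑ u ∈ F, w₂ u ≤ 2 * (θ * A.card) := by
    rw [← mul_add, hW₁, hW₂]
    nlinarith
  rw [Finset.sum_congr rfl hm₁₂, ← Finset.sum_div, Finset.sum_add_distrib]
  nlinarith [mul_le_mul_of_nonneg_left hs hg]

/-- If every set on which the walk from `s` has accumulated mass at least `θ` expands inside `F`,
then the position of the walk at its `k`-th visit to `F` is spread out. -/
lemma occupation_sum_le (hP : EntrywiseNonneg P) (hsymm : Pᵀ = P)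
    (hrow : ∀ u, ∑ v, P u v = 1) (hlazy : ∀ u, 1 / 2 ≤ P u u) {s : V} (hs : s ∈ F) {θ φ : ℝ}
    (hθ : 0 ≤ θ) (hφ : 0 ≤ φ) (m : ℕ)
    (hcut : ∀ A ⊆ F, A.Nonempty → (∀ v ∈ A, θ ≤ ∑ τ ∈ Finset.range (m + 1), (P ^ τ) s v) →
      φ * A.card ≤ ∑ u ∈ A, ∑ v ∈ F \ A, P u v) (k : ℕ) :
    ∀ A ⊆ F, ∑ v ∈ A, occupation P F m k s v ≤
      θ * A.card + Real.exp (-φ ^ 2 / 2) ^ k * √A.card := by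
  induction k with
  | zero =>
    intro A hA
    have hocc : ∀ v ∈ F, occupation P F m 0 s v = (1 : Matrix V V ℝ) s v := by
      intro v hv
      clear hcut
      induction m with
      | zero => rw [occupation_zero, visits_zero_zero]
      | succ m ih =>
        have h : visits P F (m + 1) 0 = visits P F m 0 * P * coordProj Fᶜ := by
          simp [visits, fewVisits_succ_succ]
        rw [occupation_succ, Matrix.add_apply, ih, h, mul_coordProj_apply, if_neg (by simpa)]
        simp
    rw [Finset.sum_congr rfl fun v hv => (hocc v (hA hv)).trans Matrix.one_apply]
    have hA0 : (0 : ℝ) ≤ θ * A.card := by positivity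
    simp only [Finset.sum_ite_eq, pow_zero, one_mul]
    split_ifs with h
    · have : (1 : ℝ) ≤ √A.card := by
        rw [Real.one_le_sqrt]
        exact_mod_cast Finset.card_pos.2 ⟨s, h⟩
      linarith
    · positivity
  | succ k ih =>
    intro A hA
    set A' := A.filter fun v => θ ≤ occupation P F m (k + 1) s v with hA'
    have hA'A : A' ⊆ A := Finset.filter_subset _ _
    have hcut' : φ * A'.card ≤ ∑ u ∈ A', ∑ v ∈ F \ A', excursion P F m u v := by
      rcases A'.eq_empty_or_nonempty with h | h
      · simp [h]
      refine (hcut A' (hA'A.trans hA) h fun v hv => ?_).trans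
        (Finset.sum_le_sum fun u _ => Finset.sum_le_sum fun v _ => le_excursion hP m u v)
      refine (Finset.mem_filter.1 hv).2.trans ?_
      rw [occupation, Matrix.sum_apply]
      exact Finset.sum_le_sum fun τ _ => visits_le_pow hP τ _ s v
    have hstep := lovasz_simonovits_step (excursion_nonneg (F := F) hP m)
      (excursion_transpose hsymm m) (sum_excursion_le_one hP hrow m)
      (fun u => (hlazy u).trans (le_excursion hP m u u)) hθ
      (pow_nonneg (Real.exp_pos _).le k) hφ ih (hA'A.trans hA) hcut'
    have hle : ∑ v ∈ A', occupation P F m (k + 1) s v ≤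
        ∑ u ∈ F, occupation P F m k s u * ∑ v ∈ A', excursion P F m u v := by
      simp only [Finset.mul_sum]
      rw [Finset.sum_comm]
      exact Finset.sum_le_sum fun v hv => occupation_succ_le hP m k hs (hA (hA'A hv))
    have hrest : ∑ v ∈ A \ A', occupation P F m (k + 1) s v ≤ θ * (A \ A').card := by
      rw [mul_comm, ← nsmul_eq_mul]
      refine Finset.sum_le_card_nsmul _ _ _ fun v hv => ?_
      simp only [hA', Finset.mem_sdiff, Finset.mem_filter, not_and, not_le] at hv
      exact (hv.2 hv.1).le
    have hcard : ((A \ A').card : ℝ) + A'.card = A.card := by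
      exact_mod_cast Finset.card_sdiff_add_card_eq_card hA'A
    have hsqrt : √(A'.card : ℝ) ≤ √A.card := by
      gcongr
    have hg : 0 ≤ Real.exp (-φ ^ 2 / 2) ^ (k + 1) := by positivity
    rw [← Finset.sum_sdiff hA'A, ← hcard, pow_succ]
    rw [pow_succ] at hg
    rw [← hcard] at hsqrt
    nlinarith [mul_le_mul_of_nonneg_left hsqrt hg]

/-- The walk restricted to at least `k` visits to `F` is bounded entrywise. -/
lemma pow_sub_fewVisits_le (hP : EntrywiseNonneg P) (hcol : ∀ v, ∑ u, P u v = 1) (s : V)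
    (k m : ℕ) {μ : ℝ} (hμ0 : 0 ≤ μ) (hμ : ∀ v ∈ F, occupation P F m (k + 1) s v ≤ μ) (t : ℕ)
    (ht : t ≤ m) (v : V) : (P ^ t - fewVisits P F t (k + 1)) s v ≤ t * μ := by
  induction t generalizing v with
  | zero => simp
  | succ t ih =>
    have h1 : ((P ^ t - fewVisits P F t (k + 1)) * P) s v ≤ t * μ := by
      rw [Matrix.mul_apply]
      calc _ ≤ ∑ u, (t * μ) * P u v := Finset.sum_le_sum fun u _ =>
            mul_le_mul_of_nonneg_right (ih (by omega) u) (hP u v)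
        _ = t * μ := by rw [← Finset.mul_sum, hcol, mul_one]
    have h2 : (visits P F (t + 1) (k + 1) * coordProj F) s v ≤ μ := by
      rw [mul_coordProj_apply]
      split_ifs with hv
      · refine le_trans ?_ (hμ v hv)
        rw [occupation, Matrix.sum_apply]
        exact Finset.single_le_sum (f := fun τ => visits P F τ (k + 1) s v)
          (fun τ _ => visits_nonneg hP τ _ s v) (Finset.mem_range.2 (by omega))
      · exact hμ0
    rw [pow_sub_fewVisits_succ, Matrix.add_apply]
    push_cast
    linarith

end Chain

lemma clipNormSq_le {W : Type*} [Fintype W] {x y : W → ℝ} {ξ : ℝ}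
    (hy : ∀ v, 0 ≤ y v ∧ y v ≤ x v) (hxy : ∑ v, |x v - y v| ≤ ξ) :
    clipNormSq x ξ ≤ ∑ v, y v ^ 2 :=
  csInf_le ⟨0, by rintro r ⟨z, -, -, rfl⟩; exact Finset.sum_nonneg fun v _ => sq_nonneg _⟩
    ⟨y, hy, hxy, rfl⟩

section Graph

open scoped Matrix

variable {V : Type*} [Fintype V] {G : SimpleGraph V} [DecidableRel G.Adj] {d : ℕ}

lemma half_le_one_sub_degree (hd : 1 ≤ d) (hdeg : ∀ v, G.degree v ≤ d) (u : V) :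
    (1 : ℝ) / 2 ≤ 1 - (G.degree u : ℝ) / (2 * d) := by
  have hd' : (1 : ℝ) ≤ d := by exact_mod_cast hd
  have h : (G.degree u : ℝ) ≤ d := by exact_mod_cast hdeg u
  have : (G.degree u : ℝ) / (2 * d) ≤ 1 / 2 := by
    rw [div_le_div_iff₀ (by positivity) (by norm_num)]
    linarith
  linarith

lemma ncard_crossing_le {β : Type*} [DecidableEq β] (f : V → β) :
    {e : Sym2 V | e ∈ G.edgeSet ∧ ¬ (e.map f).IsDiag}.ncard ≤
      ((G.interedges Finset.univ Finset.univ).filter fun e => f e.1 ≠ f e.2).card := by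
  rw [← Set.ncard_coe_finset]
  refine (Set.ncard_le_ncard (t := Set.image (fun e : V × V => s(e.1, e.2))
    ((G.interedges Finset.univ Finset.univ).filter fun e => f e.1 ≠ f e.2 : Finset (V × V)))
    ?_ (Set.toFinite _)).trans (Set.ncard_image_le (Set.toFinite _))
  rintro e ⟨he, hd⟩
  induction e with
  | _ u v =>
    refine ⟨(u, v), ?_, rfl⟩
    simp only [SimpleGraph.mem_edgeSet, Sym2.map_mk, Sym2.mk_isDiag_iff] at he hd
    simpa [SimpleGraph.mem_interedges_iff] using ⟨he, hd⟩

variable [DecidableEq V]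

lemma lazyStep_nonneg (hd : 1 ≤ d) (hdeg : ∀ v, G.degree v ≤ d) :
    EntrywiseNonneg (lazyStep G d) := fun u v => by
  have := half_le_one_sub_degree hd hdeg u
  simp only [lazyStep, Matrix.of_apply]
  split_ifs
  · positivity
  · linarith
  · exact le_rfl

lemma lazyStep_transpose : (lazyStep G d)ᵀ = lazyStep G d := by
  ext u v
  simp only [lazyStep, Matrix.transpose_apply, Matrix.of_apply, G.adj_comm v u]
  by_cases h : u = v
  · subst h; rfl
  · simp [h, Ne.symm h]

lemma lazyStep_self (u : V) : lazyStep G d u u = 1 - (G.degree u : ℝ) / (2 * d) := by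
  simp [lazyStep]

lemma sum_lazyStep (u : V) : ∑ v, lazyStep G d u v = 1 := by
  have h : ∀ v, lazyStep G d u v = (if G.Adj u v then 1 / (2 * (d : ℝ)) else 0) +
      if u = v then 1 - (G.degree u : ℝ) / (2 * d) else 0 := by
    intro v
    by_cases huv : u = v
    · subst huv; simp [lazyStep]
    · simp [lazyStep, huv]
  simp only [h, Finset.sum_add_distrib, Finset.sum_ite_eq, Finset.mem_univ, if_true]
  rw [← Finset.sum_filter, Finset.sum_const, ← SimpleGraph.neighborFinset_eq_filter,
    SimpleGraph.card_neighborFinset_eq_degree, nsmul_eq_mul]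
  ring

lemma card_interedges_le_sum_lazyStep (hd : 1 ≤ d) (hdeg : ∀ v, G.degree v ≤ d)
    (A B : Finset V) :
    ((G.interedges A B).card : ℝ) ≤ 2 * d * ∑ u ∈ A, ∑ v ∈ B, lazyStep G d u v := by
  have hd' : (1 : ℝ) ≤ d := by exact_mod_cast hd
  rw [← Finset.sum_product' A B fun u v => lazyStep G d u v,
    SimpleGraph.interedges_def, Finset.card_filter, Nat.cast_sum,
    Finset.mul_sum]
  refine Finset.sum_le_sum fun e _ => ?_
  split_ifs with h
  · rw [lazyStep, Matrix.of_apply, if_pos h]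
    apply le_of_eq
    push_cast
    field_simp
  · have := lazyStep_nonneg hd hdeg e.1 e.2
    push_cast
    positivity

/-- If the walk from `s` usually visits `F` often within `ℓ` steps, and has large clipped norm,
then it discovers a set that is sparsely connected to the rest of `F`. -/
lemma exists_sparse_of_clipNormSq_gt (hd : 1 ≤ d) (hdeg : ∀ v, G.degree v ≤ d) {F : Finset V}
    {s : V} (hs : s ∈ F) {θ φ : ℝ} (hθ : 0 ≤ θ) (hφ : 0 ≤ φ) (ℓ k : ℕ)
    (hfew : ∑ v, fewVisits (lazyStep G d) F ℓ (k + 1) s v ≤ 1 / 4)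
    (hclip : ℓ * (θ + Real.exp (-φ ^ 2 / 2) ^ (k + 1)) <
      clipNormSq (walkDist G d ℓ s) (1 / 4)) :
    ∃ A ⊆ F, A.Nonempty ∧
      (∀ v ∈ A, θ ≤ ∑ τ ∈ Finset.range (ℓ + 1), walkDist G d τ s v) ∧
      ((G.interedges A (F \ A)).card : ℝ) ≤ 2 * d * φ * A.card := by
  have hP := lazyStep_nonneg hd hdeg
  have hrow : ∀ u, ∑ v, lazyStep G d u v = 1 := sum_lazyStep
  have hcol : ∀ v, ∑ u, lazyStep G d u v = 1 := fun v => by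
    rw [← hrow v]
    exact Finset.sum_congr rfl fun u _ => congrFun (congrFun lazyStep_transpose v) u
  by_contra! hcon
  have hcut : ∀ A ⊆ F, A.Nonempty →
      (∀ v ∈ A, θ ≤ ∑ τ ∈ Finset.range (ℓ + 1), (lazyStep G d ^ τ) s v) →
      φ * A.card ≤ ∑ u ∈ A, ∑ v ∈ F \ A, lazyStep G d u v := by
    intro A hA hne hreach
    have h1 := (hcon A hA hne hreach).le.trans (card_interedges_le_sum_lazyStep hd hdeg A (F \ A))
    have hd' : (0 : ℝ) < 2 * d := by positivity
    rw [mul_assoc] at h1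
    exact le_of_mul_le_mul_left h1 hd'
  set μ := θ + Real.exp (-φ ^ 2 / 2) ^ (k + 1) with hμdef
  have hμ0 : 0 ≤ μ := by positivity
  have hocc := occupation_sum_le hP lazyStep_transpose hrow
    (fun u => by rw [lazyStep_self]; exact half_le_one_sub_degree hd hdeg u) hs hθ hφ ℓ hcut (k + 1)
  have hμ : ∀ v ∈ F, occupation (lazyStep G d) F ℓ (k + 1) s v ≤ μ := fun v hv => by
    simpa using hocc {v} (by simpa)
  set y : V → ℝ := (lazyStep G d ^ ℓ - fewVisits (lazyStep G d) F ℓ (k + 1)) s with hy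
  have hy0 : ∀ v, 0 ≤ y v := pow_sub_fewVisits_nonneg hP ℓ (k + 1) s
  have hyx : ∀ v, walkDist G d ℓ s v - y v = fewVisits (lazyStep G d) F ℓ (k + 1) s v :=
    fun v => by simp [hy, walkDist]
  have hfew0 := fewVisits_nonneg (F := F) hP ℓ (k + 1) s
  have hymax : ∀ v, y v ≤ ℓ * μ := pow_sub_fewVisits_le hP hcol s k ℓ hμ0 hμ ℓ le_rfl
  have hsum : ∀ t, ∑ v, (lazyStep G d ^ t) s v = 1 := by
    intro t
    induction t with
    | zero => simp [Matrix.one_apply]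
    | succ t ih =>
      simp only [pow_succ, Matrix.mul_apply]
      rw [Finset.sum_comm]
      simp only [← Finset.mul_sum, hrow, mul_one, ih]
  have hysum : ∑ v, y v ≤ 1 := by
    rw [← hsum ℓ]
    refine Finset.sum_le_sum fun v _ => ?_
    have := hyx v
    rw [walkDist] at this
    linarith [hfew0 v]
  have hclip' : clipNormSq (walkDist G d ℓ s) (1 / 4) ≤ ∑ v, y v ^ 2 := by
    refine clipNormSq_le (fun v => ⟨hy0 v, by linarith [hyx v, hfew0 v]⟩) ?_
    simpa only [hyx, abs_of_nonneg (hfew0 _)] using hfew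
  have hsq : ∑ v, y v ^ 2 ≤ ℓ * μ := by
    calc ∑ v, y v ^ 2 ≤ ∑ v, (ℓ * μ) * y v := Finset.sum_le_sum fun v _ => by
          rw [sq]; exact mul_le_mul_of_nonneg_right (hymax v) (hy0 v)
      _ = (ℓ * μ) * ∑ v, y v := by rw [Finset.mul_sum]
      _ ≤ ℓ * μ := mul_le_of_le_one_right (by positivity) hysum
  linarith

/-- In a set `F` that is not too small, most vertices are good starting points. -/
lemma exists_sparse_of_ncard (hd : 1 ≤ d) (hdeg : ∀ v, G.degree v ≤ d) {F S : Finset V}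
    {θ φ κ : ℝ} (hθ : 0 ≤ θ) (hφ : 0 ≤ φ) {ℓ k : ℕ} (hℓ : 0 < ℓ)
    (hS : ∀ s ∈ S, κ < clipNormSq (walkDist G d ℓ s) (1 / 4))
    (hκ : ℓ * (θ + Real.exp (-φ ^ 2 / 2) ^ (k + 1)) ≤ κ)
    (hF : (Fintype.card V - S.card : ℝ) + 4 * (Fintype.card V * ((k + 1) / ℓ)) < F.card) :
    ∃ s, ∃ A ⊆ F, A.Nonempty ∧
      (∀ v ∈ A, θ ≤ ∑ τ ∈ Finset.range (ℓ + 1), walkDist G d τ s v) ∧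
      ((G.interedges A (F \ A)).card : ℝ) ≤ 2 * d * φ * A.card := by
  have hP := lazyStep_nonneg hd hdeg
  have hℓ' : (0 : ℝ) < ℓ := by exact_mod_cast hℓ
  obtain ⟨s, hs, hfew⟩ : ∃ s ∈ F ∩ S,
      ∑ v, fewVisits (lazyStep G d) F ℓ (k + 1) s v ≤ 1 / 4 := by
    by_contra! hcon
    have h1 := mul_sum_fewVisits_le (F := F) hP lazyStep_transpose sum_lazyStep ℓ (k + 1)
    have h2 : ((F ∩ S).card : ℝ) * (1 / 4) ≤
        ∑ u ∈ F, ∑ v, fewVisits (lazyStep G d) F ℓ (k + 1) u v := by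
      rw [← nsmul_eq_mul]
      refine (Finset.card_nsmul_le_sum _ _ _ fun u hu => (hcon u hu).le).trans ?_
      exact Finset.sum_le_sum_of_subset_of_nonneg Finset.inter_subset_left fun u _ _ =>
        Finset.sum_nonneg fun v _ => fewVisits_nonneg hP ℓ (k + 1) u v
    have h3 : (F.card : ℝ) + S.card ≤ Fintype.card V + (F ∩ S).card := by
      have := Finset.card_union_add_card_inter F S
      have := Finset.card_le_univ (F ∪ S)
      exact_mod_cast (by omega : F.card + S.card ≤ Fintype.card V + (F ∩ S).card)
    have h4 : ∑ u ∈ F, ∑ v, fewVisits (lazyStep G d) F ℓ (k + 1) u v ≤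
        Fintype.card V * ((k + 1) / ℓ) := by
      rw [← mul_div_assoc, le_div_iff₀ hℓ', mul_comm]
      exact_mod_cast h1
    linarith
  rw [Finset.mem_inter] at hs
  exact ⟨s, exists_sparse_of_clipNormSq_gt hd hdeg hs.1 hθ hφ ℓ k hfew
    (hκ.trans_lt (hS s hs.2))⟩

/-- Greedy decomposition: repeatedly splitting off sparse sets with property `R` as long as the
remaining set is large, at the end splitting into singletons. -/
lemma exists_labelling_of_forall_exists_sparse (hdeg : ∀ v, G.degree v ≤ d)
    (R : Finset V → Prop) (hR : ∀ v, R {v}) {a b : ℝ} (ha : 0 ≤ a)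
    (h : ∀ F : Finset V, b < F.card → ∃ A ⊆ F, A.Nonempty ∧ R A ∧
      ((G.interedges A (F \ A)).card : ℝ) ≤ a * A.card) (F : Finset V) :
    ∃ f : V → Finset V, (∀ v ∈ F, v ∈ f v ∧ R (f v)) ∧
      (((G.interedges F F).filter fun e => f e.1 ≠ f e.2).card : ℝ) ≤
        2 * a * F.card + d * b := by
  induction F using Finset.strongInduction with
  | H F ih =>
    rcases le_or_gt (F.card : ℝ) b with hF | hF
    · refine ⟨fun v => {v}, fun v _ => ⟨Finset.mem_singleton_self v, hR v⟩, ?_⟩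
      have h1 : (G.interedges F F).card ≤ d * F.card := by
        rw [SimpleGraph.interedges_def, Finset.card_filter, Finset.sum_product, mul_comm]
        refine Finset.sum_le_card_nsmul _ _ _ fun u _ => (le_trans ?_ (hdeg u))
        rw [← Finset.card_filter, ← G.card_neighborFinset_eq_degree,
          SimpleGraph.neighborFinset_eq_filter]
        exact Finset.card_le_card (Finset.filter_subset_filter _ (Finset.subset_univ _))
      have h2 : (((G.interedges F F).filter fun e => ({e.1} : Finset V) ≠ {e.2}).card : ℝ) ≤
          d * F.card := by
        exact_mod_cast (Finset.card_le_card (Finset.filter_subset _ _)).trans h1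
      have h3 : (d : ℝ) * F.card ≤ d * b := by gcongr
      have h4 : 0 ≤ 2 * a * F.card := by positivity
      linarith
    · obtain ⟨A, hAF, hne, hRA, hcut⟩ := h F hF
      obtain ⟨f, hf, hcard⟩ := ih (F \ A) (Finset.sdiff_ssubset hAF hne)
      refine ⟨fun v => if v ∈ A then A else f v, fun v hv => ?_, ?_⟩
      · by_cases hvA : v ∈ A
        · simpa [hvA] using hRA
        · simpa [hvA] using hf v (Finset.mem_sdiff.2 ⟨hv, hvA⟩)
      · have hsub : (G.interedges F F).filter (fun e =>
            (if e.1 ∈ A then A else f e.1) ≠ if e.2 ∈ A then A else f e.2) ⊆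
            ((G.interedges (F \ A) (F \ A)).filter fun e => f e.1 ≠ f e.2) ∪
              (G.interedges A (F \ A) ∪ G.interedges (F \ A) A) := by
          intro e he
          simp only [Finset.mem_filter, Finset.mem_union, SimpleGraph.mem_interedges_iff,
            Finset.mem_sdiff] at he ⊢
          by_cases h1 : e.1 ∈ A <;> by_cases h2 : e.2 ∈ A <;> simp_all
        have h1 := (Finset.card_le_card hsub).trans ((Finset.card_union_le _ _).trans
          (Nat.add_le_add_left (Finset.card_union_le _ _) _))
        have := G.symm
        rw [show (G.interedges (F \ A) A).card = (G.interedges A (F \ A)).card from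
          Rel.card_interedges_comm _ _] at h1
        have h2 : ((F \ A).card : ℝ) + A.card = F.card := by
          exact_mod_cast Finset.card_sdiff_add_card_eq_card hAF
        have h3 := (Nat.cast_le (α := ℝ)).2 h1
        push_cast at h3
        rw [← h2]
        linarith

end Graph

section Parameters

variable {ℓ : ℕ} {c : ℝ}

lemma two_le_rpow_tenth (hℓ : 1024 ≤ ℓ) : (2 : ℝ) ≤ (ℓ : ℝ) ^ ((1 : ℝ) / 10) := by
  have h : (1024 : ℝ) ≤ ℓ := by exact_mod_cast hℓ
  calc (2 : ℝ) = (1024 : ℝ) ^ ((1 : ℝ) / 10) := by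
        rw [show (1024 : ℝ) = 2 ^ (10 : ℝ) by norm_num, ← Real.rpow_mul (by norm_num)]
        norm_num
    _ ≤ _ := by gcongr

lemma one_le_log (hℓ : 1024 ≤ ℓ) : 1 ≤ Real.log ℓ := by
  have h : (1024 : ℝ) ≤ ℓ := by exact_mod_cast hℓ
  rw [Real.le_log_iff_exp_le (by linarith)]
  linarith [Real.exp_one_lt_d9]

lemma rpow_tenth_pow (ℓ : ℕ) : ((ℓ : ℝ) ^ ((1 : ℝ) / 10)) ^ 10 = ℓ := by
  rw [← Real.rpow_natCast, ← Real.rpow_mul (by positivity)]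
  norm_num

lemma rpow_neg_fifth (ℓ : ℕ) :
    (ℓ : ℝ) ^ (-(1 : ℝ) / 5) = (((ℓ : ℝ) ^ ((1 : ℝ) / 10)) ^ 2)⁻¹ := by
  rw [← Real.rpow_natCast, ← Real.rpow_mul (by positivity), ← Real.rpow_neg (by positivity)]
  norm_num

lemma rpow_add_div_le (hc : 1 < c) (hℓ : 1024 ≤ ℓ) :
    (ℓ : ℝ) ^ (-(1 : ℝ) / 5) + 4 * ((⌈((ℓ : ℝ) ^ ((1 : ℝ) / 10)) ^ 5⌉₊ + 1) / ℓ) ≤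
      4 * √(c * (ℓ : ℝ) ^ (-(1 : ℝ) / 5) * Real.log ℓ) := by
  have hlog := one_le_log hℓ
  have hq := two_le_rpow_tenth hℓ
  rw [rpow_neg_fifth]
  have hq10 := rpow_tenth_pow ℓ
  set q := (ℓ : ℝ) ^ ((1 : ℝ) / 10)
  have hsqrt : q⁻¹ ≤ √(c * (q ^ 2)⁻¹ * Real.log ℓ) := by
    refine Real.le_sqrt_of_sq_le ?_
    rw [inv_pow]
    have : 0 ≤ (q ^ 2)⁻¹ := by positivity
    nlinarith [mul_le_mul hc.le hlog (by norm_num) (by linarith)]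
  have hceil : (⌈q ^ 5⌉₊ : ℝ) + 1 ≤ 2 * q ^ 5 := by
    have h1 := (Nat.ceil_lt_add_one (show 0 ≤ q ^ 5 by positivity)).le
    have h2 : (2 : ℝ) ^ 5 ≤ q ^ 5 := by gcongr
    norm_num at h2
    linarith
  have h1 : ((⌈q ^ 5⌉₊ : ℝ) + 1) / ℓ ≤ q⁻¹ / 8 := by
    rw [← hq10, div_le_iff₀ (by positivity)]
    have h2 : q⁻¹ / 8 * q ^ 10 = q ^ 5 * q ^ 4 / 8 := by field_simp
    have h3 : (2 : ℝ) ^ 4 ≤ q ^ 4 := by gcongr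
    rw [h2]
    nlinarith [show 0 ≤ q ^ 5 by positivity]
  have h2 : (q ^ 2)⁻¹ ≤ q⁻¹ := by
    gcongr
    nlinarith
  have h3 : 0 ≤ q⁻¹ := by positivity
  linarith

lemma mul_add_exp_le (hc : 1 < c) (hℓ : 1024 ≤ ℓ) :
    (ℓ : ℝ) * (1 / (8 * (ℓ : ℝ) ^ (c + 1)) +
      Real.exp (-√(c * (ℓ : ℝ) ^ (-(1 : ℝ) / 5) * Real.log ℓ) ^ 2 / 2) ^
        (⌈((ℓ : ℝ) ^ ((1 : ℝ) / 10)) ^ 5⌉₊ + 1)) ≤ (ℓ : ℝ) ^ (-c) := by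
  have hlog := one_le_log hℓ
  have hq := two_le_rpow_tenth hℓ
  have hL : (1024 : ℝ) ≤ ℓ := by exact_mod_cast hℓ
  have hL0 : (0 : ℝ) < ℓ := by linarith
  rw [rpow_neg_fifth]
  set q := (ℓ : ℝ) ^ ((1 : ℝ) / 10)
  have hc0 : 0 < (ℓ : ℝ) ^ (-c) := Real.rpow_pos_of_pos hL0 _
  have h1 : (ℓ : ℝ) * (1 / (8 * (ℓ : ℝ) ^ (c + 1))) = (ℓ : ℝ) ^ (-c) / 8 := by
    rw [Real.rpow_add hL0, Real.rpow_one, Real.rpow_neg hL0.le]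
    field_simp
  have h2 : Real.exp (-√(c * (q ^ 2)⁻¹ * Real.log ℓ) ^ 2 / 2) ^ (⌈q ^ 5⌉₊ + 1) ≤
      (ℓ : ℝ) ^ (-c) / ℓ ^ 2 := by
    have hexp : (ℓ : ℝ) ^ (-c) / ℓ ^ 2 = Real.exp (-((c + 2) * Real.log ℓ)) := by
      rw [← Real.rpow_natCast, ← Real.rpow_sub hL0, Real.rpow_def_of_pos hL0]
      congr 1; push_cast; ring
    rw [hexp, ← Real.exp_nat_mul, Real.exp_le_exp, Real.sq_sqrt (by positivity)]
    have hceil : q ^ 5 ≤ ((⌈q ^ 5⌉₊ + 1 : ℕ) : ℝ) := by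
      push_cast; linarith [Nat.le_ceil (q ^ 5)]
    have hle : q ^ 5 * (c * (q ^ 2)⁻¹ * Real.log ℓ / 2) ≤
        ((⌈q ^ 5⌉₊ + 1 : ℕ) : ℝ) * (c * (q ^ 2)⁻¹ * Real.log ℓ / 2) := by gcongr
    have heq : q ^ 5 * (c * (q ^ 2)⁻¹ * Real.log ℓ / 2) = q ^ 3 * (c * Real.log ℓ) / 2 := by
      field_simp
    have hq3 : (2 : ℝ) ^ 3 ≤ q ^ 3 := by gcongr
    have hcl : 0 ≤ c * Real.log ℓ := by positivity
    rw [heq] at hle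
    rw [neg_div, mul_neg, neg_le_neg_iff]
    nlinarith [mul_le_mul_of_nonneg_right hq3 hcl]
  have h3 : (ℓ : ℝ) * ((ℓ : ℝ) ^ (-c) / ℓ ^ 2) ≤ (ℓ : ℝ) ^ (-c) / 2 := by
    have : (ℓ : ℝ) * ((ℓ : ℝ) ^ (-c) / ℓ ^ 2) = (ℓ : ℝ) ^ (-c) / ℓ := by field_simp
    rw [this]
    gcongr
    linarith
  rw [mul_add, h1]
  linarith [mul_le_mul_of_nonneg_left h2 hL0.le]

lemma le_rpow_add_one (hc : 1 < c) (hℓ : 1024 ≤ ℓ) : (ℓ : ℝ) ≤ (ℓ : ℝ) ^ (c + 1) := by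
  have hL : (1024 : ℝ) ≤ ℓ := by exact_mod_cast hℓ
  calc (ℓ : ℝ) = (ℓ : ℝ) ^ (1 : ℝ) := (Real.rpow_one _).symm
    _ ≤ _ := Real.rpow_le_rpow_of_exponent_le (by linarith) (by linarith)

lemma succ_le_ceil (hc : 1 < c) (hℓ : 1024 ≤ ℓ) : ℓ + 1 ≤ ⌈10 * (ℓ : ℝ) ^ (c + 1)⌉₊ := by
  have hL : (1024 : ℝ) ≤ ℓ := by exact_mod_cast hℓ
  have h := Nat.le_ceil (10 * (ℓ : ℝ) ^ (c + 1))
  have : ((ℓ + 1 : ℕ) : ℝ) ≤ ⌈10 * (ℓ : ℝ) ^ (c + 1)⌉₊ := by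
    push_cast
    linarith [le_rpow_add_one hc hℓ]
  exact_mod_cast this

end Parameters

/-- decomposition theorem: if almost all vertices have large clipped walk norm,
then `V` can be partitioned (into the fibers of some `f : V → Fin b`) so that every part is
reachable by short walks from a single vertex and few edges cross the partition. -/
theorem discoverable_partition :
    ∃ ℓ₀ : ℕ, ∀ (V : Type) [Fintype V] [DecidableEq V] (G : SimpleGraph V)
      [DecidableRel G.Adj] (d : ℕ), 1 ≤ d → (∀ v, G.degree v ≤ d) →
      ∀ c : ℝ, 1 < c → ∀ ℓ : ℕ, ℓ₀ ≤ ℓ →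
      (1 - (ℓ : ℝ) ^ (-(1 : ℝ) / 5)) * (Fintype.card V : ℝ) ≤
        ({s : V | (ℓ : ℝ) ^ (-c) < clipNormSq (walkDist G d ℓ s) (1 / 4)}.ncard : ℝ) →
      ∃ (b : ℕ) (f : V → Fin b),
        (∀ i : Fin b, ∃ s : V, ∀ v : V, f v = i →
          1 / (8 * (ℓ : ℝ) ^ (c + 1)) ≤
            ∑ t ∈ Finset.range ⌈10 * (ℓ : ℝ) ^ (c + 1)⌉₊, walkDist G d t s v) ∧
        ({e : Sym2 V | e ∈ G.edgeSet ∧ ¬ (e.map f).IsDiag}.ncard : ℝ) ≤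
          8 * d * (Fintype.card V : ℝ) * Real.sqrt (c * (ℓ : ℝ) ^ (-(1 : ℝ) / 5) * Real.log ℓ) := by
  refine ⟨1024, fun V _ _ G _ d hd hdeg c hc ℓ hℓ hS => ?_⟩
  set ψ := √(c * (ℓ : ℝ) ^ (-(1 : ℝ) / 5) * Real.log ℓ) with hψ
  have hψ0 : 0 ≤ ψ := Real.sqrt_nonneg _
  have hpos : (1024 : ℝ) ≤ (ℓ : ℝ) ^ (c + 1) :=
    le_trans (by exact_mod_cast hℓ) (le_rpow_add_one hc hℓ)
  have hwalk : ∀ t s v, 0 ≤ walkDist G d t s v := fun t s v =>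
    (lazyStep_nonneg hd hdeg).pow t s v
  let R : Finset V → Prop := fun A => ∃ s, ∀ v ∈ A, 1 / (8 * (ℓ : ℝ) ^ (c + 1)) ≤
    ∑ t ∈ Finset.range ⌈10 * (ℓ : ℝ) ^ (c + 1)⌉₊, walkDist G d t s v
  have hsub := Finset.range_mono (succ_le_ceil hc hℓ)
  have hR : ∀ v, R {v} := by
    refine fun v => ⟨v, fun u hu => ?_⟩
    rw [Finset.mem_singleton.1 hu]
    calc 1 / (8 * (ℓ : ℝ) ^ (c + 1)) ≤ 1 := by
          rw [div_le_one (by positivity)]; linarith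
      _ = walkDist G d 0 v v := by simp [walkDist]
      _ ≤ _ := Finset.single_le_sum (f := fun t => walkDist G d t v v)
        (fun t _ => hwalk t v v) (hsub (Finset.mem_range.2 (Nat.succ_pos ℓ)))
  have hsparse : ∀ F : Finset V, 4 * ψ * Fintype.card V < F.card → ∃ A ⊆ F, A.Nonempty ∧ R A ∧
      ((G.interedges A (F \ A)).card : ℝ) ≤ 2 * d * ψ * A.card := by
    intro F hF
    rw [Set.ncard_eq_toFinset_card'] at hS
    obtain ⟨s, A, hAF, hne, hreach, hcut⟩ := exists_sparse_of_ncard hd hdeg (F := F)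
      (S := {s : V | (ℓ : ℝ) ^ (-c) < clipNormSq (walkDist G d ℓ s) (1 / 4)}.toFinset)
      (θ := 1 / (8 * (ℓ : ℝ) ^ (c + 1))) (by positivity) hψ0 (by omega : 0 < ℓ)
      (fun s hs => (Set.mem_toFinset.1 hs :)) (mul_add_exp_le hc hℓ) (by
        have h := mul_le_mul_of_nonneg_left (rpow_add_div_le hc hℓ)
          (Nat.cast_nonneg (α := ℝ) (Fintype.card V))
        rw [← hψ] at h
        linarith)
    exact ⟨A, hAF, hne, ⟨s, fun v hv => (hreach v hv).trans
      (Finset.sum_le_sum_of_subset_of_nonneg hsub fun t _ _ => hwalk t s v)⟩, hcut⟩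
  obtain ⟨f, hf, hcard⟩ := exists_labelling_of_forall_exists_sparse hdeg R hR (by positivity)
    hsparse Finset.univ
  rcases isEmpty_or_nonempty V with hV | ⟨⟨v₀⟩⟩
  · refine ⟨0, isEmptyElim, fun i => i.elim0, ?_⟩
    refine (Nat.cast_le.2 (ncard_crossing_le _)).trans ?_
    rw [Finset.card_eq_zero.2 (Finset.eq_empty_of_isEmpty _)]
    push_cast
    positivity
  · let e := Fintype.equivFin (Finset V)
    refine ⟨Fintype.card (Finset V), fun v => e (f v), fun i => ?_, ?_⟩
    · by_cases hi : ∃ v, e (f v) = i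
      · obtain ⟨v, rfl⟩ := hi
        obtain ⟨s, hs⟩ := (hf v (Finset.mem_univ v)).2
        refine ⟨s, fun u hu => hs u ?_⟩
        rw [← e.injective hu]
        exact (hf u (Finset.mem_univ u)).1
      · exact ⟨v₀, fun v hv => absurd ⟨v, hv⟩ hi⟩
    · refine (Nat.cast_le.2 (ncard_crossing_le _)).trans ?_
      simp only [ne_eq, e.injective.eq_iff]
      refine hcard.trans (le_of_eq ?_)
      rw [Finset.card_univ]
      ring
end
end

section
/- Let c > 1 and let ℓ be a sufficiently large integer (ℓ ≥ ℓ₀ for an absolute constant ℓ₀). Suppose S ⊆ V satisfies |S| > n/ℓ^{1/5} and ‖clip(p_s^ℓ, 1/4)‖₂² > ℓ^{−c} for every s ∈ S. Then there exists S′ ⊆ S with |S′| ≥ |S|/2 such that for every s ∈ S′, the distribution P_s^{ℓ^{1/5}} of the endpoint of an ℓ^{1/5}-hop walk from s in the projected chain M_S satisfies ‖P_s^{ℓ^{1/5}}‖_∞ ≥ 1/(2ℓ^{c+1}). -/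
open scoped Classical

noncomputable section

/-- The probability of a particular trajectory `w` of `t` steps of the lazy random walk. -/
def walkProb {V : Type*} [Fintype V] [DecidableEq V] (G : SimpleGraph V) [DecidableRel G.Adj]
    (d t : ℕ) (w : Fin (t + 1) → V) : ℝ :=
  ∏ i : Fin t, lazyStep G d (w i.castSucc) (w i.succ)

/-- `projTrans G d S t u v`: the probability of the length-`t` transition from `u` to `v` in
the Markov chain projected onto `S`, i.e. the total probability of `t`-step lazy walks in `G`
from `u` to `v` whose intermediate vertices all lie outside `S`. -/
def projTrans {V : Type*} [Fintype V] [DecidableEq V] (G : SimpleGraph V) [DecidableRel G.Adj]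
    (d : ℕ) (S : Finset V) (t : ℕ) (u v : V) : ℝ :=
  ∑ w : Fin (t + 1) → V,
    if w 0 = u ∧ w (Fin.last t) = v ∧
        (∀ i : Fin (t + 1), i ≠ 0 → i ≠ Fin.last t → w i ∉ S) then
      walkProb G d t w
    else 0

/-- `projWalkDist G d S h s v`: the probability that the `h`-hop walk in the projected chain
`M_S` started at `s ∈ S` ends at `v ∈ S`. -/
def projWalkDist {V : Type*} [Fintype V] [DecidableEq V] (G : SimpleGraph V)
    [DecidableRel G.Adj] (d : ℕ) (S : Finset V) (h : ℕ) (s : V) : V → ℝ := fun v =>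
  ∑' ts : Fin h → ℕ,
    ∑ states : Fin (h + 1) → V,
      if states 0 = s ∧ states (Fin.last h) = v ∧ (∀ i, states i ∈ S) ∧
          (∀ i : Fin h, 1 ≤ ts i) then
        ∏ i : Fin h, projTrans G d S (ts i) (states i.castSucc) (states i.succ)
      else 0

namespace ReturnSeries

open PowerSeries Finset

set_option linter.unusedSectionVars false

variable {V : Type*} [Fintype V] [DecidableEq V]

/-- All entries of the matrix are nonnegative. -/
def EntryNonneg (M : Matrix V V ℝ) : Prop :=
  ∀ u v, 0 ≤ M u v

theorem EntryNonneg.one : EntryNonneg (1 : Matrix V V ℝ) := fun u v => by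
  rw [Matrix.one_apply]
  split_ifs <;> norm_num

theorem EntryNonneg.mul {M N : Matrix V V ℝ} (hM : EntryNonneg M) (hN : EntryNonneg N) :
    EntryNonneg (M * N) := fun u v => by
  rw [Matrix.mul_apply]
  exact sum_nonneg fun w _ => mul_nonneg (hM u w) (hN w v)

theorem EntryNonneg.pow {M : Matrix V V ℝ} (hM : EntryNonneg M) (k : ℕ) :
    EntryNonneg (M ^ k) := by
  induction k with
  | zero => simpa using EntryNonneg.one
  | succ k ih => rw [pow_succ]; exact ih.mul hM

theorem EntryNonneg.sum {ι : Type*} {s : Finset ι} {f : ι → Matrix V V ℝ}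
    (hf : ∀ i ∈ s, EntryNonneg (f i)) : EntryNonneg (∑ i ∈ s, f i) := fun u v => by
  rw [Matrix.sum_apply]
  exact sum_nonneg fun i hi => hf i hi u v

/-- All entries of all coefficients of the series are nonnegative. -/
def CoeffNonneg (f : (Matrix V V ℝ)⟦X⟧) : Prop :=
  ∀ t, EntryNonneg (coeff t f)

theorem CoeffNonneg.mul {f g : (Matrix V V ℝ)⟦X⟧} (hf : CoeffNonneg f) (hg : CoeffNonneg g) :
    CoeffNonneg (f * g) := fun t => by
  rw [coeff_mul]
  exact EntryNonneg.sum fun p _ => (hf p.1).mul (hg p.2)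

theorem CoeffNonneg.one : CoeffNonneg (1 : (Matrix V V ℝ)⟦X⟧) := fun t => by
  rw [coeff_one]
  split_ifs
  · exact EntryNonneg.one
  · exact fun _ _ => le_rfl

theorem CoeffNonneg.pow {f : (Matrix V V ℝ)⟦X⟧} (hf : CoeffNonneg f) (k : ℕ) :
    CoeffNonneg (f ^ k) := by
  induction k with
  | zero => simpa using CoeffNonneg.one
  | succ k ih => rw [pow_succ]; exact ih.mul hf

theorem CoeffNonneg.sum {ι : Type*} {s : Finset ι} {f : ι → (Matrix V V ℝ)⟦X⟧}
    (hf : ∀ i ∈ s, CoeffNonneg (f i)) : CoeffNonneg (∑ i ∈ s, f i) := fun t => by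
  rw [map_sum]
  exact EntryNonneg.sum fun i hi => hf i hi t

/-- The diagonal projection onto the coordinates in `S`. -/
def proj (S : Finset V) : Matrix V V ℝ :=
  Matrix.diagonal fun v => if v ∈ S then 1 else 0

theorem proj_nonneg (S : Finset V) : EntryNonneg (proj S) := fun u v => by
  rw [proj, Matrix.diagonal_apply]
  split_ifs <;> norm_num

theorem proj_add_proj_compl (S : Finset V) : proj S + proj Sᶜ = 1 := by
  rw [proj, proj, Matrix.diagonal_add, ← Matrix.diagonal_one]
  congr 1
  funext v
  by_cases h : v ∈ S <;> simp [h]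

theorem proj_transpose (S : Finset V) : (proj S).transpose = proj S :=
  Matrix.diagonal_transpose _

theorem proj_mul_apply (S : Finset V) (M : Matrix V V ℝ) (u v : V) :
    (proj S * M) u v = if u ∈ S then M u v else 0 := by
  simp [proj, Matrix.diagonal_mul]

theorem mul_proj_apply (S : Finset V) (M : Matrix V V ℝ) (u v : V) :
    (M * proj S) u v = if v ∈ S then M u v else 0 := by
  simp [proj, Matrix.mul_diagonal]

/-- The generating series of all walks. -/
def walkSeries (A : Matrix V V ℝ) : (Matrix V V ℝ)⟦X⟧ :=
  mk fun t => A ^ t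

/-- The generating series of the walks that avoid `S` after their start. -/
def avoidSeries (A : Matrix V V ℝ) (S : Finset V) : (Matrix V V ℝ)⟦X⟧ :=
  walkSeries (A * proj Sᶜ)

/-- The generating series of the walks that visit `S`, after their start, exactly at their end. -/
def hopSeries (A : Matrix V V ℝ) (S : Finset V) : (Matrix V V ℝ)⟦X⟧ :=
  avoidSeries A S * C (A * proj S) * X

theorem coeff_walkSeries (A : Matrix V V ℝ) (t : ℕ) : coeff t (walkSeries A) = A ^ t :=
  coeff_mk _ _

theorem coeff_hopSeries_zero (A : Matrix V V ℝ) (S : Finset V) : coeff 0 (hopSeries A S) = 0 :=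
  coeff_zero_mul_X _

theorem coeff_hopSeries_succ (A : Matrix V V ℝ) (S : Finset V) (t : ℕ) :
    coeff (t + 1) (hopSeries A S) = (A * proj Sᶜ) ^ t * (A * proj S) := by
  rw [hopSeries, coeff_succ_mul_X, coeff_mul_C, avoidSeries, coeff_walkSeries]

theorem walkSeries_eq (A : Matrix V V ℝ) : walkSeries A = 1 + C A * walkSeries A * X := by
  ext1 t
  cases t with
  | zero => simp [coeff_walkSeries]
  | succ t => simp [coeff_walkSeries, coeff_succ_mul_X, coeff_one, pow_succ']

theorem walkSeries_eq' (A : Matrix V V ℝ) : walkSeries A = 1 + walkSeries A * C A * X := by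
  ext1 t
  cases t with
  | zero => simp [coeff_walkSeries]
  | succ t => simp [coeff_walkSeries, coeff_succ_mul_X, coeff_one, pow_succ]

/-- Decomposition of a walk at its first visit to `S`. -/
theorem walkSeries_eq_avoidSeries_add (A : Matrix V V ℝ) (S : Finset V) :
    walkSeries A = avoidSeries A S + hopSeries A S * walkSeries A := by
  have hA := walkSeries_eq A
  have hU : avoidSeries A S = 1 + avoidSeries A S * C (A * proj Sᶜ) * X := walkSeries_eq' _
  have hsplit : (C A : (Matrix V V ℝ)⟦X⟧) = C (A * proj S) + C (A * proj Sᶜ) := by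
    rw [← map_add, ← mul_add, proj_add_proj_compl, mul_one]
  have hX : ∀ f g : (Matrix V V ℝ)⟦X⟧, f * X * g = f * g * X := fun f g => by
    rw [mul_assoc, X_mul, mul_assoc]
  set U := avoidSeries A S
  set W := walkSeries A
  set P := (C (A * proj S) : (Matrix V V ℝ)⟦X⟧)
  set Q := (C (A * proj Sᶜ) : (Matrix V V ℝ)⟦X⟧)
  have h1 : U * W = U + U * P * W * X + U * Q * W * X := by
    conv_lhs => rw [hA, hsplit]
    noncomm_ring
  have h2 : U * W = W + U * Q * W * X := by
    conv_lhs => rw [hU]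
    rw [add_mul, one_mul, hX]
  have h3 := h1.symm.trans h2
  rw [show hopSeries A S = U * P * X from rfl, hX]
  exact (add_right_cancel h3).symm

/-- Decomposition of a walk at its `h`-th visit to `S`. -/
theorem walkSeries_eq_sum_add (A : Matrix V V ℝ) (S : Finset V) (h : ℕ) :
    walkSeries A = (∑ j ∈ range h, hopSeries A S ^ j * avoidSeries A S) +
      hopSeries A S ^ h * walkSeries A := by
  induction h with
  | zero => simp
  | succ h ih =>
    rw [sum_range_succ, pow_succ, mul_assoc, add_assoc, ← mul_add,
      ← walkSeries_eq_avoidSeries_add]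
    exact ih

theorem coeffNonneg_walkSeries {A : Matrix V V ℝ} (hA : EntryNonneg A) :
    CoeffNonneg (walkSeries A) := fun t => by
  rw [coeff_walkSeries]
  exact hA.pow t

theorem coeffNonneg_avoidSeries {A : Matrix V V ℝ} (hA : EntryNonneg A) (S : Finset V) :
    CoeffNonneg (avoidSeries A S) :=
  coeffNonneg_walkSeries (hA.mul (proj_nonneg _))

theorem coeffNonneg_hopSeries {A : Matrix V V ℝ} (hA : EntryNonneg A) (S : Finset V) :
    CoeffNonneg (hopSeries A S) := fun t => by
  cases t with
  | zero => rw [coeff_hopSeries_zero]; exact fun _ _ => le_rfl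
  | succ t =>
    rw [coeff_hopSeries_succ]
    exact ((hA.mul (proj_nonneg _)).pow t).mul (hA.mul (proj_nonneg _))

/-- Coefficientwise transposition. -/
def transposeSeries (f : (Matrix V V ℝ)⟦X⟧) : (Matrix V V ℝ)⟦X⟧ :=
  mk fun t => (coeff t f).transpose

theorem coeff_transposeSeries (f : (Matrix V V ℝ)⟦X⟧) (t : ℕ) :
    coeff t (transposeSeries f) = (coeff t f).transpose :=
  coeff_mk _ _

theorem transposeSeries_mul (f g : (Matrix V V ℝ)⟦X⟧) :
    transposeSeries (f * g) = transposeSeries g * transposeSeries f := by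
  ext1 t
  rw [coeff_transposeSeries, coeff_mul, coeff_mul, Matrix.transpose_sum,
    ← Finset.Nat.sum_antidiagonal_swap]
  exact sum_congr rfl fun p _ => by
    simp only [coeff_transposeSeries, Matrix.transpose_mul, Prod.fst_swap, Prod.snd_swap]

theorem transposeSeries_pow (f : (Matrix V V ℝ)⟦X⟧) (k : ℕ) :
    transposeSeries (f ^ k) = transposeSeries f ^ k := by
  induction k with
  | zero =>
    ext1 t
    rw [coeff_transposeSeries, pow_zero, pow_zero, coeff_one]
    split_ifs <;> simp
  | succ k ih => rw [pow_succ, transposeSeries_mul, ih, pow_succ']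

theorem transposeSeries_C (M : Matrix V V ℝ) :
    transposeSeries (C M) = C M.transpose := by
  ext1 t
  rw [coeff_transposeSeries, coeff_C, coeff_C]
  split_ifs <;> simp

theorem mul_pow_mul_comm (M N : Matrix V V ℝ) (t : ℕ) : (M * N) ^ t * M = M * (N * M) ^ t :=
  ((show SemiconjBy M (N * M) (M * N) from (mul_assoc M N M).symm).pow_right t).eq.symm

variable {A : Matrix V V ℝ}

theorem transposeSeries_hopSeries_mul (hA : A.transpose = A) (S : Finset V) :
    transposeSeries (hopSeries A S) * C (proj S) = C (proj S) * hopSeries A S := by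
  ext1 t
  rw [coeff_mul_C, coeff_C_mul, coeff_transposeSeries]
  cases t with
  | zero => simp [coeff_hopSeries_zero]
  | succ t =>
    rw [coeff_hopSeries_succ, Matrix.transpose_mul, Matrix.transpose_pow, Matrix.transpose_mul,
      Matrix.transpose_mul, proj_transpose, proj_transpose, hA, mul_assoc (proj S) A,
      ← mul_pow_mul_comm]
    simp only [mul_assoc]

theorem transposeSeries_avoidSeries_mul (hA : A.transpose = A) (S : Finset V) :
    transposeSeries (avoidSeries A S) * C (proj S) =
      C (proj S) + C (proj Sᶜ) * hopSeries A S := by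
  ext1 t
  rw [coeff_mul_C, map_add, coeff_C_mul, coeff_transposeSeries, avoidSeries, coeff_walkSeries,
    Matrix.transpose_pow, Matrix.transpose_mul, proj_transpose, hA]
  cases t with
  | zero => simp [coeff_hopSeries_zero]
  | succ t =>
    rw [coeff_hopSeries_succ, coeff_C, if_neg t.succ_ne_zero, zero_add, pow_succ,
      ← mul_assoc, mul_pow_mul_comm]
    simp only [mul_assoc]

/-- Time reversal: walks from `S` with `j` returns correspond to walks whose end is their
`j`-th or `(j+1)`-st visit to `S` after the start. -/
theorem transposeSeries_proj_mul (hA : A.transpose = A) (S : Finset V) (j : ℕ) :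
    transposeSeries (C (proj S) * (hopSeries A S ^ j * avoidSeries A S)) =
      C (proj S) * hopSeries A S ^ j + C (proj Sᶜ) * hopSeries A S ^ (j + 1) := by
  have hpow : transposeSeries (hopSeries A S) ^ j * C (proj S) =
      C (proj S) * hopSeries A S ^ j :=
    ((show SemiconjBy (C (proj S)) (hopSeries A S) (transposeSeries (hopSeries A S)) from
      (transposeSeries_hopSeries_mul hA S).symm).pow_right j).eq.symm
  rw [transposeSeries_mul, transposeSeries_mul, transposeSeries_pow, transposeSeries_C,
    proj_transpose, mul_assoc, hpow, ← mul_assoc, transposeSeries_avoidSeries_mul hA, add_mul,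
    mul_assoc, ← pow_succ']

/-- The sum of the entries of a row. -/
def rowSum (M : Matrix V V ℝ) (u : V) : ℝ :=
  ∑ v, M u v

theorem rowSum_nonneg {M : Matrix V V ℝ} (hM : EntryNonneg M) (u : V) : 0 ≤ rowSum M u :=
  sum_nonneg fun v _ => hM u v

theorem rowSum_add (M N : Matrix V V ℝ) (u : V) : rowSum (M + N) u = rowSum M u + rowSum N u :=
  sum_add_distrib

theorem rowSum_sum {ι : Type*} (s : Finset ι) (f : ι → Matrix V V ℝ) (u : V) :
    rowSum (∑ i ∈ s, f i) u = ∑ i ∈ s, rowSum (f i) u := by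
  simp only [rowSum, Matrix.sum_apply]
  exact sum_comm

theorem rowSum_mul (M N : Matrix V V ℝ) (u : V) :
    rowSum (M * N) u = ∑ v, M u v * rowSum N v := by
  simp only [rowSum, Matrix.mul_apply, mul_sum]
  exact sum_comm

theorem rowSum_mul_of_rowSum_eq_one (M : Matrix V V ℝ) {N : Matrix V V ℝ}
    (hN : ∀ v, rowSum N v = 1) (u : V) : rowSum (M * N) u = rowSum M u := by
  rw [rowSum_mul]
  simp only [hN, mul_one]
  rfl

theorem rowSum_one (u : V) : rowSum (1 : Matrix V V ℝ) u = 1 := by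
  simp [rowSum, Matrix.one_apply]

theorem rowSum_pow (hrow : ∀ v, rowSum A v = 1) (t : ℕ) (u : V) : rowSum (A ^ t) u = 1 := by
  induction t with
  | zero => rw [pow_zero, rowSum_one]
  | succ t ih => rw [pow_succ, rowSum_mul_of_rowSum_eq_one _ hrow, ih]

theorem rowSum_proj_mul (S : Finset V) (M : Matrix V V ℝ) (u : V) :
    rowSum (proj S * M) u = if u ∈ S then rowSum M u else 0 := by
  simp only [rowSum, proj_mul_apply]
  split_ifs <;> simp

theorem rowSum_pow_le (hM : EntryNonneg A) (hrow : ∀ v, rowSum A v ≤ 1) (t : ℕ) (u : V) :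
    rowSum (A ^ t) u ≤ 1 := by
  induction t with
  | zero => rw [pow_zero, rowSum_one]
  | succ t ih =>
    rw [pow_succ, rowSum_mul]
    exact (sum_le_sum fun v _ => mul_le_of_le_one_right (hM.pow t u v) (hrow v)).trans ih

/-- The probability that the walk has made at least `h` visits to `S` by time `t`. -/
theorem rowSum_coeff_hop_mul_walk (hrow : ∀ v, rowSum A v = 1) (S : Finset V) (h t : ℕ) (u : V) :
    rowSum (coeff t (hopSeries A S ^ h * walkSeries A)) u =
      ∑ a ∈ range (t + 1), rowSum (coeff a (hopSeries A S ^ h)) u := by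
  rw [coeff_mul, rowSum_sum, Finset.Nat.sum_antidiagonal_eq_sum_range_succ_mk]
  refine sum_congr rfl fun a _ => ?_
  rw [coeff_walkSeries]
  exact rowSum_mul_of_rowSum_eq_one _ (rowSum_pow hrow _) u

/-- The probability that the walk from `u` has made fewer than `h` visits to `S` by time `t`. -/
def missProb (A : Matrix V V ℝ) (S : Finset V) (h t : ℕ) (u : V) : ℝ :=
  rowSum (coeff t (∑ j ∈ range h, hopSeries A S ^ j * avoidSeries A S)) u

theorem missProb_nonneg (hA : EntryNonneg A) (S : Finset V) (h t : ℕ) (u : V) :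
    0 ≤ missProb A S h t u :=
  rowSum_nonneg (CoeffNonneg.sum (fun j _ => ((coeffNonneg_hopSeries hA S).pow j).mul
    (coeffNonneg_avoidSeries hA S)) t) u

theorem missProb_add (hrow : ∀ v, rowSum A v = 1) (S : Finset V) (h t : ℕ) (u : V) :
    missProb A S h t u + ∑ a ∈ range (t + 1), rowSum (coeff a (hopSeries A S ^ h)) u = 1 := by
  rw [missProb, ← rowSum_coeff_hop_mul_walk hrow, ← rowSum_add, ← map_add,
    ← walkSeries_eq_sum_add, coeff_walkSeries, rowSum_pow hrow]

theorem sum_rowSum_coeff_hopSeries_pow_le (hA : EntryNonneg A) (hrow : ∀ v, rowSum A v = 1)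
    (S : Finset V) (h t : ℕ) (u : V) :
    ∑ a ∈ range (t + 1), rowSum (coeff a (hopSeries A S ^ h)) u ≤ 1 := by
  have := missProb_add hrow S h t u
  have := missProb_nonneg hA S h t u
  linarith

theorem missProb_anti (hA : EntryNonneg A) (hrow : ∀ v, rowSum A v = 1)
    (S : Finset V) (h : ℕ) (u : V) : Antitone fun t => missProb A S h t u := by
  refine antitone_nat_of_succ_le fun t => ?_
  have h1 := missProb_add hrow S h t u
  have h2 := missProb_add hrow S h (t + 1) u
  rw [sum_range_succ] at h2
  have h3 := rowSum_nonneg (((coeffNonneg_hopSeries hA S).pow h) (t + 1)) u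
  linarith

theorem sum_rowSum_transpose (M : Matrix V V ℝ) : ∑ u, rowSum M.transpose u = ∑ u, rowSum M u :=
  sum_comm

theorem sum_rowSum_hop_mul_avoid_le (hA : EntryNonneg A) (hsymm : A.transpose = A)
    (hrow : ∀ v, rowSum A v = 1) (S : Finset V) (j t : ℕ) :
    ∑ a ∈ range (t + 1), ∑ s ∈ S, rowSum (coeff a (hopSeries A S ^ j * avoidSeries A S)) s ≤
      Fintype.card V := by
  have key : ∀ a, ∑ s ∈ S, rowSum (coeff a (hopSeries A S ^ j * avoidSeries A S)) s =
      ∑ v, ((if v ∈ S then rowSum (coeff a (hopSeries A S ^ j)) v else 0) +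
        (if v ∈ Sᶜ then rowSum (coeff a (hopSeries A S ^ (j + 1))) v else 0)) := by
    intro a
    have h := congrArg (fun f => ∑ u, rowSum (coeff a f) u) (transposeSeries_proj_mul hsymm S j)
    simp only [coeff_transposeSeries, sum_rowSum_transpose, map_add, coeff_C_mul, rowSum_add,
      rowSum_proj_mul] at h
    rw [← h, sum_ite_mem, univ_inter]
  simp only [key]
  rw [sum_comm]
  calc _ ≤ ∑ _v : V, (1 : ℝ) := sum_le_sum fun v _ => ?_
    _ = Fintype.card V := by simp
  by_cases hv : v ∈ S
  · simpa [hv] using sum_rowSum_coeff_hopSeries_pow_le hA hrow S j t v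
  · simpa [hv] using sum_rowSum_coeff_hopSeries_pow_le hA hrow S (j + 1) t v

theorem sum_missProb_le (hA : EntryNonneg A) (hsymm : A.transpose = A)
    (hrow : ∀ v, rowSum A v = 1) (S : Finset V) (h t : ℕ) :
    (t + 1) * ∑ s ∈ S, missProb A S h t s ≤ h * Fintype.card V := by
  calc (t + 1) * ∑ s ∈ S, missProb A S h t s
      = ∑ _a ∈ range (t + 1), ∑ s ∈ S, missProb A S h t s := by simp
    _ ≤ ∑ a ∈ range (t + 1), ∑ s ∈ S, missProb A S h a s :=
        sum_le_sum fun a ha => sum_le_sum fun s _ =>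
          missProb_anti hA hrow S h s (Nat.lt_succ_iff.1 (mem_range.1 ha))
    _ = ∑ j ∈ range h, ∑ a ∈ range (t + 1), ∑ s ∈ S,
          rowSum (coeff a (hopSeries A S ^ j * avoidSeries A S)) s := by
        simp only [missProb, map_sum, rowSum_sum]
        exact (sum_congr rfl fun a _ => sum_comm).trans sum_comm
    _ ≤ ∑ _j ∈ range h, (Fintype.card V : ℝ) :=
        sum_le_sum fun j _ => sum_rowSum_hop_mul_avoid_le hA hsymm hrow S j t
    _ = h * Fintype.card V := by simp


theorem prod_ofFn_apply (h : ℕ) (M : Fin h → Matrix V V ℝ) (s v : V) :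
    (List.ofFn M).prod s v = ∑ w : Fin (h + 1) → V,
      if w 0 = s ∧ w (Fin.last h) = v then ∏ i, M i (w i.castSucc) (w i.succ) else 0 := by
  induction h generalizing s with
  | zero =>
    rw [← (Equiv.funUnique (Fin 1) V).symm.sum_comp]
    simp [Matrix.one_apply, ite_and]
  | succ h ih =>
    rw [List.ofFn_succ, List.prod_cons, Matrix.mul_apply,
      ← (Fin.consEquiv fun _ => V).sum_comp, Fintype.sum_prod_type]
    simp only [ih, mul_sum, Fin.consEquiv_apply, Fin.prod_univ_succ, Fin.cons_zero,
      Fin.cons_succ, ← Fin.succ_last, ← Fin.succ_castSucc, Fin.castSucc_zero, ite_and,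
      mul_ite, mul_zero]
    rw [sum_comm, sum_comm (s := (univ : Finset V))]
    refine sum_congr rfl fun w _ => ?_
    simp

theorem sum_piFinset_prod_ofFn {R : Type*} [Semiring R] (K : ℕ → R) (T : Finset ℕ) (h : ℕ) :
    ∑ ts ∈ Fintype.piFinset (fun _ : Fin h => T), (List.ofFn fun i => K (ts i)).prod =
      (∑ t ∈ T, K t) ^ h := by
  induction h with
  | zero => simp
  | succ h ih =>
    rw [pow_succ', ← ih, sum_mul_sum, ← sum_product']
    refine sum_nbij' (fun ts => (ts 0, Fin.tail ts)) (fun p => Fin.cons p.1 p.2) ?_ ?_ ?_ ?_ ?_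
    · intro ts hts
      simp only [Fintype.mem_piFinset, mem_product] at hts ⊢
      exact ⟨hts 0, fun i => hts i.succ⟩
    · intro p hp
      simp only [Fintype.mem_piFinset, mem_product] at hp ⊢
      exact fun i => Fin.cases hp.1 hp.2 i
    · intro ts _
      exact Fin.cons_self_tail ts
    · intro p _
      simp
    · intro ts _
      simp [List.ofFn_succ, Fin.tail]

theorem coeff_pow_le (hA : EntryNonneg A) (S : Finset V) (h N t : ℕ) (ht : t < N) (u v : V) :
    coeff t (hopSeries A S ^ h) u v ≤ ((∑ a ∈ range N, coeff a (hopSeries A S)) ^ h) u v := by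
  have hT := coeffNonneg_hopSeries hA S
  have hQ : EntryNonneg (∑ a ∈ range N, coeff a (hopSeries A S)) :=
    EntryNonneg.sum fun a _ => hT a
  induction h generalizing t u with
  | zero =>
    rw [pow_zero, pow_zero, coeff_one]
    split_ifs
    · exact le_rfl
    · exact EntryNonneg.one u v
  | succ h ih =>
    rw [pow_succ', pow_succ', coeff_mul, Finset.Nat.sum_antidiagonal_eq_sum_range_succ_mk,
      sum_mul, Matrix.sum_apply, Matrix.sum_apply]
    refine (sum_le_sum fun a _ => ?_).trans
      (sum_le_sum_of_subset_of_nonneg (range_mono (Nat.succ_le_of_lt ht))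
        fun a _ _ => (hT a).mul (hQ.pow h) u v)
    rw [Matrix.mul_apply, Matrix.mul_apply]
    exact sum_le_sum fun w _ => mul_le_mul_of_nonneg_left
      (ih (t - a) (lt_of_le_of_lt (Nat.sub_le _ _) ht) w) (hT a u w)

theorem sum_coeff_hopSeries_pow_apply_le_one (hA : EntryNonneg A) (hrow : ∀ v, rowSum A v = 1)
    (S : Finset V) (N h : ℕ) (u v : V) :
    ((∑ a ∈ range N, coeff a (hopSeries A S)) ^ h) u v ≤ 1 := by
  have hT := coeffNonneg_hopSeries hA S
  have hQ : EntryNonneg (∑ a ∈ range N, coeff a (hopSeries A S)) :=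
    EntryNonneg.sum fun a _ => hT a
  refine (single_le_sum (f := fun v => ((∑ a ∈ range N, coeff a (hopSeries A S)) ^ h) u v)
    (fun w _ => hQ.pow h u w) (mem_univ v)).trans (rowSum_pow_le hQ (fun w => ?_) h u)
  rw [rowSum_sum]
  refine le_trans ?_ (sum_rowSum_coeff_hopSeries_pow_le hA hrow S 1 N w)
  rw [pow_one]
  exact sum_le_sum_of_subset_of_nonneg (range_mono N.le_succ)
    fun a _ _ => rowSum_nonneg (hT a) w

/-- The weight of an `h`-step composition of hops is at most the total over all hop lengths. -/
theorem coeff_hopSeries_pow_apply_le_tsum (hA : EntryNonneg A) (hrow : ∀ v, rowSum A v = 1)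
    (S : Finset V) (h t : ℕ) (u v : V) :
    coeff t (hopSeries A S ^ h) u v ≤
      ∑' ts : Fin h → ℕ, (List.ofFn fun i => coeff (ts i) (hopSeries A S)).prod u v := by
  have hnn : ∀ ts : Fin h → ℕ,
      0 ≤ (List.ofFn fun i => coeff (ts i) (hopSeries A S)).prod u v := fun ts => by
    rw [prod_ofFn_apply]
    refine sum_nonneg fun w _ => ?_
    split_ifs
    · exact prod_nonneg fun i _ => coeffNonneg_hopSeries hA S _ _ _
    · exact le_rfl
  have hbox : ∀ N, ∑ ts ∈ Fintype.piFinset (fun _ : Fin h => range N),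
      (List.ofFn fun i => coeff (ts i) (hopSeries A S)).prod u v =
        ((∑ a ∈ range N, coeff a (hopSeries A S)) ^ h) u v := fun N => by
    rw [← sum_piFinset_prod_ofFn (fun a => coeff a (hopSeries A S)), Matrix.sum_apply]
  have hsum : Summable fun ts : Fin h → ℕ =>
      (List.ofFn fun i => coeff (ts i) (hopSeries A S)).prod u v := by
    refine summable_of_sum_le hnn (c := 1) fun F => ?_
    have hF : F ⊆ Fintype.piFinset
        (fun _ : Fin h => range (F.sup (fun ts => ∑ i, ts i) + 1)) := fun ts hts => by
      rw [Fintype.mem_piFinset]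
      intro i
      rw [mem_range, Nat.lt_succ_iff]
      exact (single_le_sum (fun _ _ => Nat.zero_le _) (mem_univ i)).trans
        (le_sup (f := fun ts : Fin h → ℕ => ∑ i, ts i) hts)
    refine (sum_le_sum_of_subset_of_nonneg hF fun ts _ _ => hnn ts).trans ?_
    rw [hbox]
    exact sum_coeff_hopSeries_pow_apply_le_one hA hrow S _ h u v
  refine (coeff_pow_le hA S h (t + 1) t t.lt_succ_self u v).trans ?_
  rw [← hbox]
  exact hsum.sum_le_tsum _ fun ts _ => hnn ts

section Graph

variable (G : SimpleGraph V) [DecidableRel G.Adj] {d : ℕ}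

theorem lazyStep_nonneg (hd : 1 ≤ d) (hdeg : ∀ v, G.degree v ≤ d) :
    EntryNonneg (lazyStep G d) := fun u v => by
  have hd' : (1 : ℝ) ≤ d := by exact_mod_cast hd
  have hu : (G.degree u : ℝ) ≤ d := by exact_mod_cast hdeg u
  rw [lazyStep, Matrix.of_apply]
  split_ifs
  · positivity
  · rw [sub_nonneg, div_le_one (by linarith)]
    linarith
  · exact le_rfl

theorem lazyStep_transpose (d : ℕ) : (lazyStep G d).transpose = lazyStep G d := by
  ext u v
  simp only [lazyStep, Matrix.transpose_apply, Matrix.of_apply, G.adj_comm v u]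
  by_cases h : u = v
  · subst h; rfl
  · rw [if_neg h, if_neg (Ne.symm h)]

theorem rowSum_lazyStep (d : ℕ) (u : V) : rowSum (lazyStep G d) u = 1 := by
  have h : ∀ v, lazyStep G d u v = (if G.Adj u v then 1 / (2 * d : ℝ) else 0) +
      if u = v then 1 - (G.degree u : ℝ) / (2 * d) else 0 := fun v => by
    rw [lazyStep, Matrix.of_apply]
    by_cases huv : u = v
    · subst huv; simp
    · simp [huv]
  simp only [rowSum, h, sum_add_distrib, sum_ite_eq, mem_univ, if_true]
  rw [← sum_filter, sum_const, ← G.neighborFinset_eq_filter, G.card_neighborFinset_eq_degree,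
    nsmul_eq_mul]
  ring

theorem projTrans_succ (d : ℕ) (S : Finset V) (m : ℕ) (u v : V) :
    projTrans G d S (m + 1) u v = ((lazyStep G d * proj Sᶜ) ^ m * lazyStep G d) u v := by
  have hprod : (lazyStep G d * proj Sᶜ) ^ m * lazyStep G d =
      (List.ofFn fun i : Fin (m + 1) =>
        if i = 0 then lazyStep G d else proj Sᶜ * lazyStep G d).prod := by
    rw [mul_pow_mul_comm, List.ofFn_succ]
    simp [Fin.succ_ne_zero, List.ofFn_const]
  rw [hprod, prod_ofFn_apply, projTrans]
  refine sum_congr rfl fun w _ => ?_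
  have hfac : ∀ i : Fin (m + 1),
      (if i = 0 then lazyStep G d else proj Sᶜ * lazyStep G d) (w i.castSucc) (w i.succ) =
        if (i ≠ 0 → w i.castSucc ∉ S) then lazyStep G d (w i.castSucc) (w i.succ) else 0 := by
    intro i
    by_cases hi : i = 0
    · simp [hi]
    · simp [hi, proj_mul_apply]
  simp only [hfac, prod_ite_zero, mem_univ, true_imp_iff, walkProb]
  have hiff : (∀ i : Fin (m + 1 + 1), i ≠ 0 → i ≠ Fin.last (m + 1) → w i ∉ S) ↔
      ∀ i : Fin (m + 1), i ≠ 0 → w i.castSucc ∉ S := by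
    rw [Fin.forall_fin_succ']
    simp [Fin.castSucc_eq_zero_iff, Fin.castSucc_ne_last]
  rw [← ite_and]
  congr 1
  rw [hiff, and_assoc]

theorem coeff_hopSeries_lazyStep (d : ℕ) (S : Finset V) (t : ℕ) (u v : V) :
    coeff t (hopSeries (lazyStep G d) S) u v =
      if v ∈ S ∧ 1 ≤ t then projTrans G d S t u v else 0 := by
  cases t with
  | zero => simp [coeff_hopSeries_zero]
  | succ m =>
    rw [coeff_hopSeries_succ, ← mul_assoc, mul_proj_apply, projTrans_succ]
    simp

theorem projWalkDist_eq_tsum (d : ℕ) (S : Finset V) (h : ℕ) {s : V} (hs : s ∈ S) (v : V) :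
    projWalkDist G d S h s v = ∑' ts : Fin h → ℕ,
      (List.ofFn fun i => coeff (ts i) (hopSeries (lazyStep G d) S)).prod s v := by
  rw [projWalkDist]
  refine tsum_congr fun ts => ?_
  rw [prod_ofFn_apply]
  refine sum_congr rfl fun w _ => ?_
  simp only [coeff_hopSeries_lazyStep, prod_ite_zero, mem_univ, true_imp_iff]
  rw [← ite_and]
  congr 1
  rw [Fin.forall_fin_succ, forall_and]
  refine propext ⟨?_, ?_⟩
  · rintro ⟨h0, hl, ⟨-, hS⟩, ht⟩
    exact ⟨⟨h0, hl⟩, hS, ht⟩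
  · rintro ⟨⟨h0, hl⟩, hS, ht⟩
    exact ⟨h0, hl, ⟨h0 ▸ hs, hS⟩, ht⟩


theorem clipNormSq_walkDist_le (hd : 1 ≤ d) (hdeg : ∀ v, G.degree v ≤ d) (S : Finset V)
    (h t : ℕ) (s : V) {ξ M : ℝ} (hmiss : missProb (lazyStep G d) S h t s ≤ ξ) (hM : 0 ≤ M)
    (hle : ∀ a v, coeff a (hopSeries (lazyStep G d) S ^ h) s v ≤ M) :
    clipNormSq (walkDist G d t s) ξ ≤ (t + 1) * M := by
  have hA := lazyStep_nonneg G hd hdeg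
  have hrow := rowSum_lazyStep G d
  have hsymm := lazyStep_transpose G d
  set A := lazyStep G d
  have hynn : EntryNonneg (coeff t (hopSeries A S ^ h * walkSeries A)) :=
    ((coeffNonneg_hopSeries hA S).pow h).mul (coeffNonneg_walkSeries hA) t
  have hrnn : EntryNonneg (coeff t (∑ j ∈ range h, hopSeries A S ^ j * avoidSeries A S)) :=
    CoeffNonneg.sum (fun j _ => ((coeffNonneg_hopSeries hA S).pow j).mul
      (coeffNonneg_avoidSeries hA S)) t
  have hsplit : ∀ w, walkDist G d t s w =
      coeff t (∑ j ∈ range h, hopSeries A S ^ j * avoidSeries A S) s w +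
        coeff t (hopSeries A S ^ h * walkSeries A) s w := fun w => by
    rw [← Matrix.add_apply, ← map_add, ← walkSeries_eq_sum_add, coeff_walkSeries]
    rfl
  have hysum : rowSum (coeff t (hopSeries A S ^ h * walkSeries A)) s ≤ 1 := by
    rw [rowSum_coeff_hop_mul_walk hrow]
    exact sum_rowSum_coeff_hopSeries_pow_le hA hrow S h t s
  have hysup : ∀ w, coeff t (hopSeries A S ^ h * walkSeries A) s w ≤ (t + 1) * M := fun w => by
    rw [coeff_mul, Matrix.sum_apply, Finset.Nat.sum_antidiagonal_eq_sum_range_succ_mk]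
    calc _ ≤ ∑ _a ∈ range (t + 1), M := sum_le_sum fun a _ => ?_
      _ = (t + 1) * M := by simp
    rw [Matrix.mul_apply, coeff_walkSeries]
    have hcol : ∑ v, (A ^ (t - a)) v w = 1 := by
      have := rowSum_pow hrow (t - a) w
      rwa [← hsymm, ← Matrix.transpose_pow] at this
    calc _ ≤ ∑ v, M * (A ^ (t - a)) v w :=
          sum_le_sum fun v _ => mul_le_mul_of_nonneg_right (hle a v) (hA.pow _ v w)
      _ = M := by rw [← mul_sum, hcol, mul_one]
  unfold clipNormSq
  refine le_trans (csInf_le ⟨0, ?_⟩ ⟨fun w => coeff t (hopSeries A S ^ h * walkSeries A) s w,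
    fun w => ⟨hynn s w, ?_⟩, ?_, rfl⟩) ?_
  · rintro r ⟨y, -, -, rfl⟩
    exact sum_nonneg fun v _ => sq_nonneg _
  · rw [hsplit]
    exact le_add_of_nonneg_left (hrnn s w)
  · simp only [hsplit, add_sub_cancel_right]
    rw [sum_congr rfl fun w _ => abs_of_nonneg (hrnn s w)]
    exact hmiss
  · calc _ ≤ ∑ w, (t + 1) * M * coeff t (hopSeries A S ^ h * walkSeries A) s w :=
          sum_le_sum fun w _ => by
            rw [sq]
            exact mul_le_mul_of_nonneg_right (hysup w) (hynn s w)
      _ = (t + 1) * M * rowSum (coeff t (hopSeries A S ^ h * walkSeries A)) s :=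
          (mul_sum _ _ _).symm
      _ ≤ (t + 1) * M := mul_le_of_le_one_right (by positivity) hysum

theorem coeff_hopSeries_pow_le_projWalkDist (hd : 1 ≤ d) (hdeg : ∀ v, G.degree v ≤ d)
    (S : Finset V) (h a : ℕ) {s : V} (hs : s ∈ S) (v : V) :
    coeff a (hopSeries (lazyStep G d) S ^ h) s v ≤ projWalkDist G d S h s v := by
  rw [projWalkDist_eq_tsum G d S h hs]
  exact coeff_hopSeries_pow_apply_le_tsum (lazyStep_nonneg G hd hdeg) (rowSum_lazyStep G d)
    S h a s v

/-- Markov's inequality for the vertices of `S` from which the walk rarely returns. -/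
theorem card_missProb_le (hd : 1 ≤ d) (hdeg : ∀ v, G.degree v ≤ d) (S : Finset V) (h t : ℕ)
    (ξ : ℝ) :
    (t + 1) * (ξ * (S.filter fun s => ¬ missProb (lazyStep G d) S h t s ≤ ξ).card) ≤
      h * Fintype.card V := by
  have hA := lazyStep_nonneg G hd hdeg
  refine le_trans (mul_le_mul_of_nonneg_left ?_ (by positivity))
    (sum_missProb_le hA (lazyStep_transpose G d) (rowSum_lazyStep G d) S h t)
  calc _ = ∑ _s ∈ S.filter fun s => ¬ missProb (lazyStep G d) S h t s ≤ ξ, ξ := by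
        simp [mul_comm]
    _ ≤ ∑ s ∈ S.filter fun s => ¬ missProb (lazyStep G d) S h t s ≤ ξ,
          missProb (lazyStep G d) S h t s :=
        sum_le_sum fun s hs => (not_le.1 (mem_filter.1 hs).2).le
    _ ≤ _ := sum_le_sum_of_subset_of_nonneg (filter_subset _ _)
        fun s _ _ => missProb_nonneg hA S h t s

end Graph

end ReturnSeries

/-- if every vertex of a large set `S` has large clipped walk norm, then for half
of `S` the `ℓ^{1/5}`-hop walk in the projected chain `M_S` has sup-norm at least
`1/(2 ℓ^{c+1})`. -/
theorem projected_infty_norm :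
    ∃ ℓ₀ : ℕ, ∀ (V : Type) [Fintype V] [DecidableEq V] (G : SimpleGraph V)
      [DecidableRel G.Adj] (d : ℕ), 1 ≤ d → (∀ v, G.degree v ≤ d) →
      ∀ c : ℝ, 1 < c → ∀ ℓ : ℕ, ℓ₀ ≤ ℓ →
      ∀ S : Finset V, (Fintype.card V : ℝ) / (ℓ : ℝ) ^ ((1 : ℝ) / 5) < S.card →
      (∀ s ∈ S, (ℓ : ℝ) ^ (-c) < clipNormSq (walkDist G d ℓ s) (1 / 4)) →
      ∃ S' ⊆ S, (S.card : ℝ) / 2 ≤ S'.card ∧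
        ∀ s ∈ S', ∃ v : V,
          1 / (2 * (ℓ : ℝ) ^ (c + 1)) ≤
            projWalkDist G d S ⌊(ℓ : ℝ) ^ ((1 : ℝ) / 5)⌋₊ s v := by
  refine ⟨32, fun V _ _ G _ d hd hdeg c hc ℓ hℓ S hS hclip => ?_⟩
  have hℓ' : (32 : ℝ) ≤ ℓ := by exact_mod_cast hℓ
  set r : ℝ := (ℓ : ℝ) ^ ((1 : ℝ) / 5) with hr
  have hr5 : r ^ 5 = ℓ := by
    rw [hr, ← Real.rpow_natCast, ← Real.rpow_mul (Nat.cast_nonneg ℓ)]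
    norm_num
  have hr0 : 0 ≤ r := by positivity
  have hr2 : 2 ≤ r := by
    refine le_of_pow_le_pow_left₀ (n := 5) (by norm_num) hr0 ?_
    rw [hr5]
    linarith
  set h := ⌊r⌋₊
  have hh : (h : ℝ) ≤ r := Nat.floor_le hr0
  refine ⟨S.filter fun s => ReturnSeries.missProb (lazyStep G d) S h ℓ s ≤ 1 / 4,
    Finset.filter_subset _ _, ?_, fun s hs => ?_⟩
  · have hbad := ReturnSeries.card_missProb_le G hd hdeg S h ℓ (1 / 4)
    have hcard := Finset.card_filter_add_card_filter_not (s := S)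
      fun s => ReturnSeries.missProb (lazyStep G d) S h ℓ s ≤ 1 / 4
    have hcard' := congrArg (Nat.cast (R := ℝ)) hcard
    rw [Nat.cast_add] at hcard'
    set b : ℝ := ((S.filter fun s =>
      ¬ ReturnSeries.missProb (lazyStep G d) S h ℓ s ≤ 1 / 4).card : ℝ)
    have hb : 0 ≤ b := Nat.cast_nonneg _
    rw [div_lt_iff₀ (by linarith)] at hS
    have h1 : (h : ℝ) * Fintype.card V ≤ r * (S.card * r) :=
      mul_le_mul hh hS.le (Nat.cast_nonneg _) hr0
    have h2 : r ^ 2 * (r ^ 3 * b) ≤ r ^ 2 * (4 * S.card) := by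
      have : r ^ 2 * (r ^ 3 * b) = ℓ * b := by rw [← hr5]; ring
      rw [this]
      nlinarith
    have h3 := le_of_mul_le_mul_left h2 (by positivity)
    have h4 : 8 * b ≤ r ^ 3 * b := by
      refine mul_le_mul_of_nonneg_right ?_ hb
      calc (8 : ℝ) = 2 ^ 3 := by norm_num
        _ ≤ r ^ 3 := by gcongr
    linarith
  · obtain ⟨hsS, hmiss⟩ := Finset.mem_filter.1 hs
    by_contra! hlt
    refine (hclip s hsS).not_ge ((ReturnSeries.clipNormSq_walkDist_le G hd hdeg S h ℓ s hmiss
      (M := 1 / (2 * (ℓ : ℝ) ^ (c + 1))) (by positivity) fun a v =>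
        (ReturnSeries.coeff_hopSeries_pow_le_projWalkDist G hd hdeg S h a hsS v).trans
          (hlt v).le).trans ?_)
    have hpos : (0 : ℝ) < ℓ := by linarith
    have hc0 : (0 : ℝ) < (ℓ : ℝ) ^ c := Real.rpow_pos_of_pos hpos c
    rw [Real.rpow_add_one hpos.ne', Real.rpow_neg hpos.le, mul_one_div,
      div_le_iff₀ (by positivity)]
    have : ((ℓ : ℝ) ^ c)⁻¹ * (2 * ((ℓ : ℝ) ^ c * ℓ)) = 2 * ℓ := by
      field_simp
    linarith
end
end

section
/- Let G be a simple graph on n vertices with maximum degree at most d, let S ⊆ V with |S| ≥ n/ℓ^{1/5}, and let ℓ be a sufficiently large integer. For s ∈ S, call the hop count of an ℓ-step lazy random walk (v₀ = s, v₁, …, v_ℓ) the number of indices i ∈ {1, …, ℓ} with v_i ∈ S. Then (1/|S|)·Σ_{s∈S} Pr[the ℓ-step lazy walk from s has hop count at most ℓ^{1/5}] ≤ 4·ℓ^{−2/5}. -/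
open scoped Classical

noncomputable section

theorem lazyStep_nonneg_s9 {V : Type*} [Fintype V] [DecidableEq V] {G : SimpleGraph V}
    [DecidableRel G.Adj] {d : ℕ} (hd : 1 ≤ d) (hG : ∀ v, G.degree v ≤ d) (u v : V) :
    0 ≤ lazyStep G d u v := by
  have hd' : (1 : ℝ) ≤ d := by exact_mod_cast hd
  have hu : (G.degree u : ℝ) ≤ d := by exact_mod_cast hG u
  simp only [lazyStep, Matrix.of_apply]
  split_ifs
  · positivity
  · rw [sub_nonneg, div_le_one (by positivity)]
    linarith
  · exact le_rfl

theorem lazyStep_comm {V : Type*} [Fintype V] [DecidableEq V] (G : SimpleGraph V)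
    [DecidableRel G.Adj] (d : ℕ) (u v : V) : lazyStep G d u v = lazyStep G d v u := by
  by_cases h : u = v
  · rw [h]
  · simp [lazyStep, G.adj_comm u v, h, Ne.symm h]

theorem sum_lazyStep_right {V : Type*} [Fintype V] [DecidableEq V] (G : SimpleGraph V)
    [DecidableRel G.Adj] (d : ℕ) (u : V) : ∑ v, lazyStep G d u v = 1 := by
  have key : ∀ v, lazyStep G d u v = (if G.Adj u v then 1 / (2 * d : ℝ) else 0) +
      (if u = v then 1 - (G.degree u : ℝ) / (2 * d) else 0) := by
    intro v
    by_cases h : u = v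
    · subst h
      simp [lazyStep]
    · simp [lazyStep, h]
  rw [Finset.sum_congr rfl fun v _ => key v, Finset.sum_add_distrib, ← Finset.sum_filter,
    Finset.sum_const, ← G.neighborFinset_eq_filter, G.card_neighborFinset_eq_degree]
  simp only [Finset.sum_ite_eq, Finset.mem_univ, if_true, nsmul_eq_mul]
  ring

theorem sum_lazyStep_left {V : Type*} [Fintype V] [DecidableEq V] (G : SimpleGraph V)
    [DecidableRel G.Adj] (d : ℕ) (v : V) : ∑ u, lazyStep G d u v = 1 := by
  rw [Finset.sum_congr rfl fun u _ => lazyStep_comm G d u v, sum_lazyStep_right]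

/-- `lowHopProb P S t k s` is the probability that the first `t` steps of the chain with
transition matrix `P` started at `s` hit `S` fewer than `k` times. -/
def lowHopProb {V : Type*} [Fintype V] (P : Matrix V V ℝ) (S : Finset V) : ℕ → ℕ → V → ℝ
  | _, 0, _ => 0
  | 0, _ + 1, _ => 1
  | t + 1, k + 1, s =>
    ∑ v, P s v * if v ∈ S then lowHopProb P S t k v else lowHopProb P S t (k + 1) v

section lowHopProb

variable {V : Type*} [Fintype V] (P : Matrix V V ℝ) (S : Finset V)

theorem lowHopProb_zero_right (t : ℕ) (s : V) : lowHopProb P S t 0 s = 0 := by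
  cases t <;> rfl

theorem lowHopProb_zero_succ (k : ℕ) (s : V) : lowHopProb P S 0 (k + 1) s = 1 := rfl

theorem lowHopProb_succ_succ (t k : ℕ) (s : V) :
    lowHopProb P S (t + 1) (k + 1) s =
      ∑ v, P s v * if v ∈ S then lowHopProb P S t k v else lowHopProb P S t (k + 1) v := rfl

variable {P}

theorem lowHopProb_nonneg (hP : ∀ u v, 0 ≤ P u v) (t k : ℕ) (s : V) :
    0 ≤ lowHopProb P S t k s := by
  induction t generalizing k s with
  | zero => cases k <;> simp [lowHopProb_zero_right, lowHopProb_zero_succ]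
  | succ t ih =>
    cases k with
    | zero => rw [lowHopProb_zero_right]
    | succ k =>
      rw [lowHopProb_succ_succ]
      refine Finset.sum_nonneg fun v _ => mul_nonneg (hP s v) ?_
      split_ifs <;> apply ih

theorem lowHopProb_zero_le_one (k : ℕ) (s : V) : lowHopProb P S 0 k s ≤ 1 := by
  cases k <;> simp [lowHopProb_zero_right, lowHopProb_zero_succ]

theorem lowHopProb_antitone (hP : ∀ u v, 0 ≤ P u v) (hrow : ∀ u, ∑ v, P u v = 1) (k : ℕ)
    (s : V) : Antitone fun t => lowHopProb P S t k s := by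
  refine antitone_nat_of_succ_le fun t => ?_
  induction t generalizing k s with
  | zero =>
    cases k with
    | zero => simp [lowHopProb_zero_right]
    | succ k =>
      rw [lowHopProb_succ_succ, lowHopProb_zero_succ, ← hrow s]
      refine Finset.sum_le_sum fun v _ => mul_le_of_le_one_right (hP s v) ?_
      split_ifs <;> apply lowHopProb_zero_le_one
  | succ t ih =>
    cases k with
    | zero => simp [lowHopProb_zero_right]
    | succ k =>
      rw [lowHopProb_succ_succ, lowHopProb_succ_succ]
      refine Finset.sum_le_sum fun v _ => mul_le_mul_of_nonneg_left ?_ (hP s v)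
      split_ifs <;> apply ih

/-- Under the stationary (uniform) distribution, the mass lost at one more step is the mass of
the walks started in `S` with exactly `k` hops. -/
theorem sum_lowHopProb_sub (hcol : ∀ v, ∑ u, P u v = 1) (t k : ℕ) :
    ∑ s, lowHopProb P S t (k + 1) s - ∑ s, lowHopProb P S (t + 1) (k + 1) s =
      ∑ s ∈ S, lowHopProb P S t (k + 1) s - ∑ s ∈ S, lowHopProb P S t k s := by
  have h : ∑ s, lowHopProb P S (t + 1) (k + 1) s =
      ∑ v, if v ∈ S then lowHopProb P S t k v else lowHopProb P S t (k + 1) v := by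
    simp only [lowHopProb_succ_succ]
    rw [Finset.sum_comm]
    refine Finset.sum_congr rfl fun v _ => ?_
    rw [← Finset.sum_mul, hcol, one_mul]
  rw [h, ← Finset.sum_sub_distrib, ← Finset.sum_sub_distrib]
  have h' : ∀ v, (lowHopProb P S t (k + 1) v -
      if v ∈ S then lowHopProb P S t k v else lowHopProb P S t (k + 1) v) =
      if v ∈ S then lowHopProb P S t (k + 1) v - lowHopProb P S t k v else 0 := by
    intro v
    split_ifs <;> simp
  rw [Finset.sum_congr rfl fun v _ => h' v, Finset.sum_ite_mem, Finset.univ_inter]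

theorem sum_range_sum_lowHopProb (hcol : ∀ v, ∑ u, P u v = 1) (ℓ k : ℕ) :
    ∑ t ∈ Finset.range ℓ, ∑ s ∈ S, lowHopProb P S t k s =
      ∑ j ∈ Finset.range k,
        (∑ s, lowHopProb P S 0 (j + 1) s - ∑ s, lowHopProb P S ℓ (j + 1) s) := by
  have h : ∀ t, ∑ s ∈ S, lowHopProb P S t k s = ∑ j ∈ Finset.range k,
      (∑ s, lowHopProb P S t (j + 1) s - ∑ s, lowHopProb P S (t + 1) (j + 1) s) := by
    intro t
    simp only [sum_lowHopProb_sub S hcol]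
    rw [Finset.sum_range_sub fun j => ∑ s ∈ S, lowHopProb P S t j s]
    simp [lowHopProb_zero_right]
  simp only [h]
  rw [Finset.sum_comm]
  exact Finset.sum_congr rfl fun j _ =>
    Finset.sum_range_sub' (fun t => ∑ s, lowHopProb P S t (j + 1) s) ℓ

theorem mul_sum_lowHopProb_le (hP : ∀ u v, 0 ≤ P u v) (hrow : ∀ u, ∑ v, P u v = 1)
    (hcol : ∀ v, ∑ u, P u v = 1) (ℓ k : ℕ) :
    (ℓ : ℝ) * ∑ s ∈ S, lowHopProb P S ℓ k s ≤ k * Fintype.card V := by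
  calc (ℓ : ℝ) * ∑ s ∈ S, lowHopProb P S ℓ k s
      = ∑ t ∈ Finset.range ℓ, ∑ s ∈ S, lowHopProb P S ℓ k s := by simp
    _ ≤ ∑ t ∈ Finset.range ℓ, ∑ s ∈ S, lowHopProb P S t k s :=
        Finset.sum_le_sum fun t ht => Finset.sum_le_sum fun s _ =>
          lowHopProb_antitone S hP hrow k s (Finset.mem_range.1 ht).le
    _ = _ := sum_range_sum_lowHopProb S hcol ℓ k
    _ ≤ ∑ j ∈ Finset.range k, (Fintype.card V : ℝ) := by
        refine Finset.sum_le_sum fun j _ => ?_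
        have := Finset.sum_nonneg fun s (_ : s ∈ Finset.univ) =>
          lowHopProb_nonneg S hP ℓ (j + 1) s
        simp only [lowHopProb_zero_succ, Finset.sum_const, Finset.card_univ, nsmul_eq_mul]
        linarith
    _ = k * Fintype.card V := by simp

end lowHopProb

theorem walkProb_cons {V : Type*} [Fintype V] [DecidableEq V] (G : SimpleGraph V)
    [DecidableRel G.Adj] (d t : ℕ) (x : V) (w : Fin (t + 1) → V) :
    walkProb G d (t + 1) (Fin.cons x w) = lazyStep G d x (w 0) * walkProb G d t w := by
  simp only [walkProb]
  rw [Fin.prod_univ_succ]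
  simp

theorem sum_walkProb_eq_lowHopProb {V : Type*} [Fintype V] [DecidableEq V] (G : SimpleGraph V)
    [DecidableRel G.Adj] (d : ℕ) (S : Finset V) (t k : ℕ) (s : V) :
    (∑ w : Fin (t + 1) → V,
      if w 0 = s ∧ (Finset.univ.filter fun i : Fin t => w i.succ ∈ S).card < k then
        walkProb G d t w else 0) = lowHopProb (lazyStep G d) S t k s := by
  induction t generalizing k s with
  | zero =>
    rw [← (Equiv.funUnique (Fin 1) V).symm.sum_comp]
    cases k <;> simp [lowHopProb_zero_right, lowHopProb_zero_succ, walkProb]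
  | succ t ih =>
    cases k with
    | zero => simp [lowHopProb_zero_right]
    | succ k =>
      rw [← (Fin.consEquiv fun _ => V).sum_comp, Fintype.sum_prod_type, lowHopProb_succ_succ]
      rw [Finset.sum_eq_single s (fun x _ hx => by simp [Fin.consEquiv, hx]) (by simp)]
      simp only [← ih, ← Finset.sum_ite_irrel, Finset.mul_sum]
      rw [Finset.sum_comm]
      refine Finset.sum_congr rfl fun w _ => ?_
      rw [Finset.sum_eq_single (w 0) (fun x _ hx => by simp [hx.symm]) (by simp)]
      by_cases h : w 0 ∈ S <;>
        simp [Fin.consEquiv, walkProb_cons, Fin.card_filter_univ_succ, h]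

/-- on average over `s ∈ S`, the probability that an `ℓ`-step lazy walk from `s`
makes at most `ℓ^{1/5}` hops into `S` is at most `4 ℓ^{-2/5}`. -/
theorem few_low_hop_walks :
    ∃ ℓ₀ : ℕ, ∀ (V : Type) [Fintype V] [DecidableEq V] (G : SimpleGraph V)
      [DecidableRel G.Adj] (d : ℕ), 1 ≤ d → (∀ v, G.degree v ≤ d) →
      ∀ ℓ : ℕ, ℓ₀ ≤ ℓ →
      ∀ S : Finset V, (Fintype.card V : ℝ) / (ℓ : ℝ) ^ ((1 : ℝ) / 5) ≤ S.card →
      (1 / (S.card : ℝ)) *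
          ∑ s ∈ S, ∑ w : Fin (ℓ + 1) → V,
            (if w 0 = s ∧
                ((Finset.univ.filter fun i : Fin ℓ => w i.succ ∈ S).card : ℝ) ≤
                  (ℓ : ℝ) ^ ((1 : ℝ) / 5) then
              walkProb G d ℓ w
            else 0) ≤
        4 * (ℓ : ℝ) ^ (-(2 : ℝ) / 5) := by
  refine ⟨1, fun V _ _ G _ d hd hG ℓ hℓ S hS => ?_⟩
  have hℓ1 : (1 : ℝ) ≤ ℓ := by exact_mod_cast hℓ
  have hℓ0 : (0 : ℝ) < ℓ := by linarith
  set h : ℝ := (ℓ : ℝ) ^ ((1 : ℝ) / 5) with hh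
  have hh1 : 1 ≤ h := Real.one_le_rpow hℓ1 (by norm_num)
  have hh0 : 0 < h := by linarith
  have hwalk : ∀ s, (∑ w : Fin (ℓ + 1) → V,
      (if w 0 = s ∧ ((Finset.univ.filter fun i : Fin ℓ => w i.succ ∈ S).card : ℝ) ≤ h then
        walkProb G d ℓ w else 0)) = lowHopProb (lazyStep G d) S ℓ (⌊h⌋₊ + 1) s := by
    intro s
    rw [← sum_walkProb_eq_lowHopProb]
    simp only [Nat.lt_succ_iff, Nat.le_floor_iff hh0.le]
  rw [Finset.sum_congr rfl fun s _ => hwalk s]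
  have hmain := mul_sum_lowHopProb_le S (lazyStep_nonneg_s9 hd hG) (sum_lazyStep_right G d)
    (sum_lazyStep_left G d) ℓ (⌊h⌋₊ + 1)
  set a := ∑ s ∈ S, lowHopProb (lazyStep G d) S ℓ (⌊h⌋₊ + 1) s
  rcases S.card.eq_zero_or_pos with hS0 | hSpos
  · rw [hS0]
    simp only [Nat.cast_zero, div_zero, zero_mul]
    positivity
  have hSpos' : (0 : ℝ) < S.card := by exact_mod_cast hSpos
  have hn : (Fintype.card V : ℝ) ≤ S.card * h := (div_le_iff₀ hh0).1 hS
  have hk : ((⌊h⌋₊ + 1 : ℕ) : ℝ) ≤ 2 * h := by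
    have := Nat.floor_le hh0.le
    push_cast
    linarith
  have ha : (ℓ : ℝ) * a ≤ 2 * h * (S.card * h) :=
    hmain.trans (mul_le_mul hk hn (by positivity) (by positivity))
  have hpow : h * h ≤ ℓ * (ℓ : ℝ) ^ (-(2 : ℝ) / 5) := by
    rw [hh, ← Real.rpow_add hℓ0, ← Real.rpow_one_add' hℓ0.le (by norm_num)]
    exact Real.rpow_le_rpow_of_exponent_le hℓ1 (by norm_num)
  have hr : 0 < (ℓ : ℝ) ^ (-(2 : ℝ) / 5) := by positivity
  rw [one_div, inv_mul_le_iff₀ hSpos']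
  refine le_of_mul_le_mul_left (ha.trans ?_) hℓ0
  calc 2 * h * (S.card * h) = 2 * S.card * (h * h) := by ring
    _ ≤ 2 * S.card * (ℓ * (ℓ : ℝ) ^ (-(2 : ℝ) / 5)) := by gcongr
    _ ≤ 4 * S.card * (ℓ * (ℓ : ℝ) ^ (-(2 : ℝ) / 5)) := by gcongr; norm_num
    _ = ℓ * (S.card * (4 * (ℓ : ℝ) ^ (-(2 : ℝ) / 5))) := by ring
end
end

section
/- Fix 0 < ε ≤ 1/2, an integer ℓ ≥ ε^{−20}, a vertex s of G, and set w = ℓ^{14}. Draw w independent samples from the distribution p_s^ℓ and let w_v be the number of samples equal to v; let T = {v : w_v ≥ ℓ⁷/2}. Then with probability at least 1 − 2^{−1/ε²}: every vertex v with p_s^ℓ(v) ≥ ℓ^{−7} belongs to T, and no vertex v with p_s^ℓ(v) ≤ ℓ^{−8} belongs to T. -/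
open scoped Classical

noncomputable section

/-- The step matrix of the lazy walk is row-stochastic when `d` bounds the degrees. -/
theorem lazyStep_mem_rowStochastic {V : Type*} [Fintype V] [DecidableEq V] (G : SimpleGraph V)
    [DecidableRel G.Adj] {d : ℕ} (hd : 1 ≤ d) (hdeg : ∀ v, G.degree v ≤ d) :
    lazyStep G d ∈ Matrix.rowStochastic ℝ V := by
  have hd0 : (0 : ℝ) < d := by exact_mod_cast hd
  rw [Matrix.mem_rowStochastic_iff_sum]
  refine ⟨fun u v => ?_, fun u => ?_⟩
  · have hu : (G.degree u : ℝ) ≤ d := by exact_mod_cast hdeg u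
    have hdiv : (G.degree u : ℝ) / (2 * d) ≤ 1 := by
      rw [div_le_one (by positivity)]
      linarith
    simp only [lazyStep, Matrix.of_apply]
    split_ifs
    · positivity
    · linarith
    · exact le_rfl
  · have hsplit : ∀ v, lazyStep G d u v =
        (if G.Adj u v then 1 / (2 * (d : ℝ)) else 0) +
          (if u = v then 1 - (G.degree u : ℝ) / (2 * d) else 0) := by
      intro v
      simp only [lazyStep, Matrix.of_apply]
      by_cases huv : u = v
      · subst huv
        simp
      · simp [huv]
    simp only [hsplit, Finset.sum_add_distrib, Finset.sum_ite_eq, Finset.mem_univ, if_true]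
    rw [← Finset.sum_filter, Finset.sum_const, ← SimpleGraph.neighborFinset_eq_filter,
      SimpleGraph.card_neighborFinset_eq_degree, nsmul_eq_mul]
    ring

theorem walkDist_nonneg {V : Type*} [Fintype V] [DecidableEq V] (G : SimpleGraph V)
    [DecidableRel G.Adj] {d : ℕ} (hd : 1 ≤ d) (hdeg : ∀ v, G.degree v ≤ d) (t : ℕ) (s v : V) :
    0 ≤ walkDist G d t s v :=
  Matrix.nonneg_of_mem_rowStochastic (pow_mem (lazyStep_mem_rowStochastic G hd hdeg) t)

theorem sum_walkDist {V : Type*} [Fintype V] [DecidableEq V] (G : SimpleGraph V)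
    [DecidableRel G.Adj] {d : ℕ} (hd : 1 ≤ d) (hdeg : ∀ v, G.degree v ≤ d) (t : ℕ) (s : V) :
    ∑ v, walkDist G d t s v = 1 :=
  Matrix.sum_row_of_mem_rowStochastic (pow_mem (lazyStep_mem_rowStochastic G hd hdeg) t) s

/-- The moment generating function of the number of occurrences of `v` among `n` independent
samples from `q`. -/
theorem sum_prod_mul_pow_card_filter {V : Type*} [Fintype V] [DecidableEq V] (q : V → ℝ)
    (hq : ∑ v, q v = 1) (n : ℕ) (c : ℝ) (v : V) :
    ∑ f : Fin n → V, (∏ i, q (f i)) * c ^ (Finset.univ.filter fun i => f i = v).card =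
      (1 + (c - 1) * q v) ^ n := by
  have hfactor : ∀ f : Fin n → V,
      (∏ i, q (f i)) * c ^ (Finset.univ.filter fun i => f i = v).card =
        ∏ i, q (f i) * (if f i = v then c else 1) := by
    intro f
    rw [Finset.prod_mul_distrib, Finset.prod_ite, Finset.prod_const, Finset.prod_const_one,
      mul_one]
  have hsum : ∑ u, q u * (if u = v then c else 1) = 1 + (c - 1) * q v := by
    have hterm : ∀ u, q u * (if u = v then c else 1) =
        q u + (if u = v then (c - 1) * q u else 0) := by
      intro u
      split_ifs <;> ring
    simp only [hterm, Finset.sum_add_distrib, hq, Finset.sum_ite_eq', Finset.mem_univ, if_true]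
  simp only [hfactor]
  rw [← Fintype.prod_sum (fun (_ : Fin n) u => q u * (if u = v then c else 1))]
  simp only [hsum, Finset.prod_const, Finset.card_univ, Fintype.card_fin]

theorem sum_prod_eq_one {V : Type*} [Fintype V] (q : V → ℝ) (hq : ∑ v, q v = 1) (n : ℕ) :
    ∑ f : Fin n → V, ∏ i, q (f i) = 1 := by
  rw [← Fintype.prod_sum (fun (_ : Fin n) u => q u)]
  simp [hq]

/-- If `g v f ≥ 0`, `g v f ≥ 1` for some `v` whenever `f` is bad, and the expectation of `g v`
is at most `q v * B`, then a random `f` is good with probability at least `1 - B`. -/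
theorem one_sub_le_sum_ite_prod {V : Type*} [Fintype V] (q : V → ℝ) (hq0 : ∀ v, 0 ≤ q v)
    (hq : ∑ v, q v = 1) {n : ℕ} (good : (Fin n → V) → Prop) [DecidablePred good]
    (g : V → (Fin n → V) → ℝ) (hg0 : ∀ v f, 0 ≤ g v f) (hg : ∀ f, ¬ good f → ∃ v, 1 ≤ g v f)
    (B : ℝ) (hB : ∀ v, ∑ f, (∏ i, q (f i)) * g v f ≤ q v * B) :
    1 - B ≤ ∑ f, if good f then ∏ i, q (f i) else 0 := by
  have hpt : ∀ f, ∏ i, q (f i) ≤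
      (if good f then ∏ i, q (f i) else 0) + ∑ v, (∏ i, q (f i)) * g v f := by
    intro f
    have hP : 0 ≤ ∏ i, q (f i) := Finset.prod_nonneg fun i _ => hq0 _
    have hterm : ∀ v ∈ Finset.univ, 0 ≤ (∏ i, q (f i)) * g v f :=
      fun v _ => mul_nonneg hP (hg0 v f)
    split_ifs with hf
    · linarith [Finset.sum_nonneg hterm]
    · obtain ⟨v, hv⟩ := hg f hf
      have hle := Finset.single_le_sum hterm (Finset.mem_univ v)
      nlinarith
  have hsum := Finset.sum_le_sum fun f (_ : f ∈ Finset.univ) => hpt f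
  rw [sum_prod_eq_one q hq n, Finset.sum_add_distrib, Finset.sum_comm] at hsum
  have hbound := Finset.sum_le_sum fun v (_ : v ∈ Finset.univ) => hB v
  rw [← Finset.sum_mul, hq] at hbound
  linarith

/-- Chernoff-type bound for the lower tail at half the mean. -/
theorem sum_prod_mul_exp_sub_card_le {V : Type*} [Fintype V] [DecidableEq V] (q : V → ℝ)
    (hq0 : ∀ v, 0 ≤ q v) (hq : ∑ v, q v = 1) (n : ℕ) (x : ℝ) (v : V) (hx : x ≤ q v * n) :
    ∑ f : Fin n → V, (∏ i, q (f i)) *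
        Real.exp (x / 2 - ((Finset.univ.filter fun i => f i = v).card : ℝ)) ≤
      Real.exp (-(x / 10)) := by
  have hexp : ∀ k : ℕ, Real.exp (x / 2 - k) = Real.exp (-1) ^ k * Real.exp (x / 2) := by
    intro k
    rw [← Real.exp_nat_mul, ← Real.exp_add]
    ring_nf
  simp only [hexp, ← mul_assoc]
  rw [← Finset.sum_mul, sum_prod_mul_pow_card_filter q hq]
  have hv1 : q v ≤ 1 := hq ▸ Finset.single_le_sum (fun u _ => hq0 u) (Finset.mem_univ v)
  have he0 := Real.exp_pos (-1)
  have he : Real.exp (-1) ≤ 2 / 5 := by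
    rw [Real.exp_neg, inv_le_comm₀ (Real.exp_pos _) (by norm_num)]
    linarith [Real.exp_one_gt_d9]
  have hbase : 1 + (Real.exp (-1) - 1) * q v ≤ Real.exp (-(3 / 5 * q v)) := by
    have := Real.add_one_le_exp (-(3 / 5 * q v))
    nlinarith [hq0 v]
  have hpow : (1 + (Real.exp (-1) - 1) * q v) ^ n ≤ Real.exp (-(3 / 5 * q v)) ^ n :=
    pow_le_pow_left₀ (by nlinarith [hq0 v]) hbase n
  calc (1 + (Real.exp (-1) - 1) * q v) ^ n * Real.exp (x / 2)
      ≤ Real.exp (-(3 / 5 * q v)) ^ n * Real.exp (x / 2) := by gcongr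
    _ = Real.exp (n * -(3 / 5 * q v) + x / 2) := by rw [← Real.exp_nat_mul, ← Real.exp_add]
    _ ≤ Real.exp (-(x / 10)) := by
      gcongr
      nlinarith

/-- Upper tail bound that is proportional to `q v`, so that it can be summed over all `v`. -/
theorem sum_prod_mul_exp_card_sub_one_le {V : Type*} [Fintype V] [DecidableEq V] (q : V → ℝ)
    (hq0 : ∀ v, 0 ≤ q v) (hq : ∑ v, q v = 1) (n : ℕ) (v : V) :
    ∑ f : Fin n → V, (∏ i, q (f i)) *
        (Real.exp ((Finset.univ.filter fun i => f i = v).card : ℝ) - 1) ≤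
      q v * (2 * n * Real.exp (2 * (q v * n))) := by
  have hexp : ∀ k : ℕ, Real.exp (k : ℝ) = Real.exp 1 ^ k := by
    intro k
    rw [← Real.exp_nat_mul, mul_one]
  simp only [hexp, mul_sub, mul_one, Finset.sum_sub_distrib]
  rw [sum_prod_mul_pow_card_filter q hq, sum_prod_eq_one q hq]
  have he := Real.exp_one_lt_d9
  have he1 := Real.exp_one_gt_d9
  have hbase : 1 + (Real.exp 1 - 1) * q v ≤ Real.exp (2 * q v) := by
    have := Real.add_one_le_exp (2 * q v)
    nlinarith [hq0 v]
  have hpow : (1 + (Real.exp 1 - 1) * q v) ^ n ≤ Real.exp (2 * (q v * n)) := by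
    calc (1 + (Real.exp 1 - 1) * q v) ^ n ≤ Real.exp (2 * q v) ^ n :=
          pow_le_pow_left₀ (by nlinarith [hq0 v]) hbase n
      _ = Real.exp (2 * (q v * n)) := by
        rw [← Real.exp_nat_mul]
        ring_nf
  have hconv : Real.exp (2 * (q v * n)) - 1 ≤
      2 * (q v * n) * Real.exp (2 * (q v * n)) := by
    have h := Real.add_one_le_exp (-(2 * (q v * n)))
    have hinv : Real.exp (-(2 * (q v * n))) * Real.exp (2 * (q v * n)) = 1 := by
      rw [← Real.exp_add]
      simp
    nlinarith [Real.exp_pos (2 * (q v * n))]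
  linarith

/-- The total failure probability is at most `exp (-l)`. -/
theorem failure_bound_le_exp_neg {l : ℝ} (hl : 2 ^ 20 ≤ l) :
    l ^ 7 * Real.exp (-(l ^ 7 / 10)) +
        2 * l ^ 14 * Real.exp (2 * l ^ 6) * (2 * Real.exp (-(l ^ 7 / 2))) ≤ Real.exp (-l) := by
  have hl6 : 2 ^ 20 ≤ l ^ 6 := hl.trans (le_self_pow₀ (by linarith) (by norm_num))
  have hx6 : 2 ^ 20 * l ^ 6 ≤ l ^ 7 := by nlinarith
  have hx1 : 2 ^ 20 * l ≤ l ^ 7 := by nlinarith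
  rw [show l ^ 14 = l ^ 7 * l ^ 7 by ring]
  set x := l ^ 7
  have hx0 : (2 : ℝ) ^ 40 ≤ x := by linarith
  have hx : x ≤ Real.exp (x / 25) := by
    have := Real.quadratic_le_exp_of_nonneg (x := x / 25) (by linarith)
    nlinarith
  have h1 : x * Real.exp (-(x / 10)) ≤ Real.exp (-(x / 20)) := by
    calc x * Real.exp (-(x / 10)) ≤ Real.exp (x / 25) * Real.exp (-(x / 10)) := by gcongr
      _ = Real.exp (x / 25 + -(x / 10)) := (Real.exp_add _ _).symm
      _ ≤ Real.exp (-(x / 20)) := by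
        gcongr
        linarith
  have h2 : 2 * (x * x) * Real.exp (2 * l ^ 6) * (2 * Real.exp (-(x / 2))) ≤
      4 * Real.exp (-(x / 20)) := by
    calc 2 * (x * x) * Real.exp (2 * l ^ 6) * (2 * Real.exp (-(x / 2)))
        ≤ 2 * (Real.exp (x / 25) * Real.exp (x / 25)) * Real.exp (2 * l ^ 6) *
            (2 * Real.exp (-(x / 2))) := by gcongr
      _ = 4 * Real.exp (x / 25 + x / 25 + 2 * l ^ 6 + -(x / 2)) := by
        simp only [Real.exp_add]
        ring
      _ ≤ 4 * Real.exp (-(x / 20)) := by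
        gcongr
        linarith
  have h5 : 5 ≤ Real.exp 4 := by linarith [Real.add_one_le_exp 4]
  calc x * Real.exp (-(x / 10)) +
        2 * (x * x) * Real.exp (2 * l ^ 6) * (2 * Real.exp (-(x / 2)))
      ≤ 5 * Real.exp (-(x / 20)) := by linarith
    _ ≤ Real.exp 4 * Real.exp (-(x / 20)) := by gcongr
    _ = Real.exp (4 + -(x / 20)) := (Real.exp_add _ _).symm
    _ ≤ Real.exp (-l) := by
      gcongr
      linarith

/-- The threshold statement for samples from an arbitrary probability vector `q`. -/
theorem one_sub_exp_neg_le_sum_threshold {V : Type*} [Fintype V] [DecidableEq V] (q : V → ℝ)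
    (hq0 : ∀ v, 0 ≤ q v) (hq : ∑ v, q v = 1) (l : ℕ) (hl : (2 : ℝ) ^ 20 ≤ l)
    (good : (Fin (l ^ 14) → V) → Prop) [DecidablePred good]
    (hgood : ∀ f, good f ↔
      (∀ v : V, 1 / (l : ℝ) ^ 7 ≤ q v →
        (l : ℝ) ^ 7 / 2 ≤ ((Finset.univ.filter fun i => f i = v).card : ℝ)) ∧
      (∀ v : V, q v ≤ 1 / (l : ℝ) ^ 8 →
        ¬ (l : ℝ) ^ 7 / 2 ≤ ((Finset.univ.filter fun i => f i = v).card : ℝ))) :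
    1 - Real.exp (-(l : ℝ)) ≤ ∑ f, if good f then ∏ i, q (f i) else 0 := by
  have hl0 : (0 : ℝ) < l := by linarith
  have hx2 : 2 ≤ (l : ℝ) ^ 7 :=
    le_trans (by linarith) (le_self_pow₀ (by linarith : (1 : ℝ) ≤ l) (by norm_num))
  set x : ℝ := (l : ℝ) ^ 7 with hx
  have hn : ((l ^ 14 : ℕ) : ℝ) = (l : ℝ) ^ 14 := by push_cast; rfl
  have hD : 0 < Real.exp (x / 2) - 1 := by linarith [Real.add_one_le_exp (x / 2)]
  have hDinv : 1 / (Real.exp (x / 2) - 1) ≤ 2 * Real.exp (-(x / 2)) := by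
    rw [div_le_iff₀ hD]
    have hinv : Real.exp (-(x / 2)) * Real.exp (x / 2) = 1 := by
      rw [← Real.exp_add]
      simp
    have hsmall : Real.exp (-(x / 2)) * 2 ≤ 1 := by
      nlinarith [Real.add_one_le_exp (x / 2), Real.exp_pos (-(x / 2))]
    linarith
  let heavy (v : V) (f : Fin (l ^ 14) → V) : ℝ :=
    if 1 / x ≤ q v then
      Real.exp (x / 2 - ((Finset.univ.filter fun i => f i = v).card : ℝ)) else 0
  let light (v : V) (f : Fin (l ^ 14) → V) : ℝ :=
    if q v ≤ 1 / (l : ℝ) ^ 8 then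
      (Real.exp ((Finset.univ.filter fun i => f i = v).card : ℝ) - 1) *
        (1 / (Real.exp (x / 2) - 1)) else 0
  have hheavy0 : ∀ v f, 0 ≤ heavy v f := by
    intro v f
    dsimp only [heavy]
    split_ifs
    · positivity
    · exact le_rfl
  have hlight0 : ∀ v f, 0 ≤ light v f := by
    intro v f
    dsimp only [light]
    split_ifs
    · have := Real.one_le_exp (Nat.cast_nonneg (α := ℝ) (Finset.univ.filter fun i => f i = v).card)
      exact mul_nonneg (by linarith) (by positivity)
    · exact le_rfl
  have hheavy : ∀ v, ∑ f, (∏ i, q (f i)) * heavy v f ≤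
      q v * (x * Real.exp (-(x / 10))) := by
    intro v
    by_cases hv : 1 / x ≤ q v
    · have hqx : 1 ≤ q v * x := (div_le_iff₀ (by linarith)).1 hv
      have hmean : x ≤ q v * (l ^ 14 : ℕ) := by
        rw [hn, show (l : ℝ) ^ 14 = x * x by rw [hx]; ring]
        nlinarith
      simp only [heavy, if_pos hv]
      refine (sum_prod_mul_exp_sub_card_le q hq0 hq _ x v hmean).trans ?_
      nlinarith [Real.exp_pos (-(x / 10))]
    · simp only [heavy, if_neg hv, mul_zero, Finset.sum_const_zero]
      have := hq0 v
      positivity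
  have hlight : ∀ v, ∑ f, (∏ i, q (f i)) * light v f ≤
      q v * (2 * (l : ℝ) ^ 14 * Real.exp (2 * (l : ℝ) ^ 6) * (2 * Real.exp (-(x / 2)))) := by
    intro v
    have hqv := hq0 v
    by_cases hv : q v ≤ 1 / (l : ℝ) ^ 8
    · have hmean : q v * (l : ℝ) ^ 14 ≤ (l : ℝ) ^ 6 := by
        have hqv8 : q v * (l : ℝ) ^ 8 ≤ 1 := (le_div_iff₀ (by positivity)).1 hv
        calc q v * (l : ℝ) ^ 14 = q v * (l : ℝ) ^ 8 * (l : ℝ) ^ 6 := by ring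
          _ ≤ 1 * (l : ℝ) ^ 6 := by gcongr
          _ = (l : ℝ) ^ 6 := one_mul _
      simp only [light, if_pos hv, ← mul_assoc]
      rw [← Finset.sum_mul]
      have hmgf := sum_prod_mul_exp_card_sub_one_le q hq0 hq (l ^ 14) v
      rw [hn] at hmgf
      calc _ ≤ q v * (2 * (l : ℝ) ^ 14 * Real.exp (2 * (q v * (l : ℝ) ^ 14))) *
            (1 / (Real.exp (x / 2) - 1)) := by gcongr
        _ ≤ q v * (2 * (l : ℝ) ^ 14 * Real.exp (2 * (l : ℝ) ^ 6)) *
            (2 * Real.exp (-(x / 2))) := by gcongr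
        _ = _ := by ring
    · simp only [light, if_neg hv, mul_zero, Finset.sum_const_zero]
      positivity
  have hmain := one_sub_le_sum_ite_prod q hq0 hq good (fun v f => heavy v f + light v f)
    (fun v f => add_nonneg (hheavy0 v f) (hlight0 v f)) ?_
    (x * Real.exp (-(x / 10)) +
      2 * (l : ℝ) ^ 14 * Real.exp (2 * (l : ℝ) ^ 6) * (2 * Real.exp (-(x / 2)))) ?_
  · linarith [failure_bound_le_exp_neg hl]
  · intro f hf
    rw [hgood, not_and_or] at hf
    push Not at hf
    rcases hf with ⟨v, hv, hcard⟩ | ⟨v, hv, hcard⟩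
    · refine ⟨v, le_add_of_le_of_nonneg ?_ (hlight0 v f)⟩
      simp only [heavy, if_pos hv]
      exact Real.one_le_exp (by linarith)
    · refine ⟨v, le_add_of_nonneg_of_le (hheavy0 v f) ?_⟩
      simp only [light, if_pos hv]
      rw [mul_one_div, one_le_div hD]
      gcongr
  · intro v
    simp only [mul_add, Finset.sum_add_distrib]
    exact add_le_add (hheavy v) (hlight v)

theorem exp_neg_le_two_rpow_neg {ε l : ℝ} (hε0 : 0 < ε) (hε : ε ≤ 1 / 2)
    (hl : ε ^ (-20 : ℤ) ≤ l) : Real.exp (-l) ≤ (2 : ℝ) ^ (-(1 / ε ^ 2)) := by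
  have hle : 1 / ε ^ 2 ≤ l := by
    refine le_trans ?_ hl
    rw [zpow_neg, one_div]
    gcongr
    exact pow_le_pow_of_le_one hε0.le (by linarith) (by norm_num)
  rw [Real.rpow_def_of_pos two_pos]
  gcongr
  have := Real.log_two_lt_d9
  have : 0 < 1 / ε ^ 2 := by positivity
  nlinarith

theorem two_pow_le_of_zpow_neg_le {ε l : ℝ} (hε0 : 0 < ε) (hε : ε ≤ 1 / 2)
    (hl : ε ^ (-20 : ℤ) ≤ l) : (2 : ℝ) ^ 20 ≤ l := by
  refine le_trans ?_ hl
  rw [zpow_neg, ← inv_zpow]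
  have : (2 : ℝ) ≤ ε⁻¹ := by
    rw [le_inv_comm₀ two_pos hε0]
    linarith
  exact pow_le_pow_left₀ two_pos.le this 20

/-- drawing `w = ℓ¹⁴` i.i.d. samples from `p_s^ℓ`, with probability at least
`1 - 2^{-1/ε²}` every vertex of probability at least `ℓ⁻⁷` gets at least `ℓ⁷/2` samples and no
vertex of probability at most `ℓ⁻⁸` does. -/
theorem estclip_threshold_set {V : Type} [Fintype V] [DecidableEq V] (G : SimpleGraph V)
    [DecidableRel G.Adj] (d : ℕ) (hd : 1 ≤ d) (hdeg : ∀ v, G.degree v ≤ d)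
    (ε : ℝ) (hε0 : 0 < ε) (hε : ε ≤ 1 / 2) (ℓ : ℕ) (hℓ : ε ^ (-20 : ℤ) ≤ (ℓ : ℝ)) (s : V) :
    1 - (2 : ℝ) ^ (-(1 / ε ^ 2)) ≤
      ∑ f : Fin (ℓ ^ 14) → V,
        if ((∀ v : V, 1 / (ℓ : ℝ) ^ 7 ≤ walkDist G d ℓ s v →
              (ℓ : ℝ) ^ 7 / 2 ≤ ((Finset.univ.filter fun i => f i = v).card : ℝ)) ∧
            (∀ v : V, walkDist G d ℓ s v ≤ 1 / (ℓ : ℝ) ^ 8 →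
              ¬ (ℓ : ℝ) ^ 7 / 2 ≤ ((Finset.univ.filter fun i => f i = v).card : ℝ))) then
          ∏ i : Fin (ℓ ^ 14), walkDist G d ℓ s (f i)
        else 0 := by
  have hthr := one_sub_exp_neg_le_sum_threshold (walkDist G d ℓ s)
    (walkDist_nonneg G hd hdeg ℓ s) (sum_walkDist G hd hdeg ℓ s) ℓ
    (two_pow_le_of_zpow_neg_le hε0 hε hℓ) _ (fun _ => Iff.rfl)
  exact (sub_le_sub_left (exp_neg_le_two_rpow_neg hε0 hε hℓ) 1).trans hthr
end
end
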